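/- arXiv:2012.12170 — 8 statements merged into one kernel-verified Lean document; each statement's English description precedes it below -/
import Mathlib

section
/- Let k ≥ 1 and let r be the smallest integer with 2r > k. Let R be the polynomial ring over ℚ in the indeterminates a, p₁, …, p_{k−1}, e, pˣ_r, …, pˣ_{k−1} (and set pˣ_i = 0 for 1 ≤ i < r). Then the 2k+1−r elements 2p_i + e·pˣ_i (for 1 ≤ i ≤ k−1), −8a + 6e², pˣ_i (for r ≤ i ≤ k−1), and 4e are algebraically independent over ℚ and generate R as a ℚ-algebra. -/
/-!
Statement 1: the 2k+1−r elements 2pᵢ + e·pˣᵢ (1 ≤ i ≤ k−1), −8a + 6e², pˣᵢ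
(r ≤ i ≤ k−1) and 4e are algebraically independent over ℚ and generate
R = ℚ[a, p₁,…,p_{k−1}, e, pˣ_r,…,pˣ_{k−1}] as a ℚ-algebra.
-/

noncomputable section

/-- Index type for the indeterminates a, p₁,…,p_{k−1}, e, pˣ_r,…,pˣ_{k−1};
it also indexes the family of the 2k+1−r elements of the statement. -/
abbrev EvenSphereVar (k r : ℕ) : Type :=
  Unit ⊕ {i : ℕ // 1 ≤ i ∧ i ≤ k - 1} ⊕ Unit ⊕ {i : ℕ // r ≤ i ∧ i ≤ k - 1}

/-- The polynomial ring R = ℚ[a, p₁,…,p_{k−1}, e, pˣ_r,…,pˣ_{k−1}]. -/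
abbrev EvenSphereRing (k r : ℕ) : Type := MvPolynomial (EvenSphereVar k r) ℚ

/-- The indeterminate `a`. -/
def esA (k r : ℕ) : EvenSphereRing k r := MvPolynomial.X (Sum.inl ())

/-- The indeterminate `pᵢ` (for 1 ≤ i ≤ k−1). -/
def esP (k r : ℕ) (i : ℕ) : EvenSphereRing k r :=
  if h : 1 ≤ i ∧ i ≤ k - 1 then MvPolynomial.X (Sum.inr (Sum.inl ⟨i, h⟩)) else 0

/-- The indeterminate `e`. -/
def esE (k r : ℕ) : EvenSphereRing k r := MvPolynomial.X (Sum.inr (Sum.inr (Sum.inl ())))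

/-- The indeterminate `pˣᵢ` (for r ≤ i ≤ k−1), with the convention pˣᵢ = 0 for i < r. -/
def esPx (k r : ℕ) (i : ℕ) : EvenSphereRing k r :=
  if h : r ≤ i ∧ i ≤ k - 1 then MvPolynomial.X (Sum.inr (Sum.inr (Sum.inr ⟨i, h⟩))) else 0

/-- The family consisting of the 2k+1−r elements
−8a + 6e², 2pᵢ + e·pˣᵢ (1 ≤ i ≤ k−1), 4e and pˣᵢ (r ≤ i ≤ k−1). -/
def esFam (k r : ℕ) : EvenSphereVar k r → EvenSphereRing k r := fun v =>
  match v with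
  | Sum.inl _ => -8 * esA k r + 6 * esE k r ^ 2
  | Sum.inr (Sum.inl ⟨i, _⟩) => 2 * esP k r i + esE k r * esPx k r i
  | Sum.inr (Sum.inr (Sum.inl _)) => 4 * esE k r
  | Sum.inr (Sum.inr (Sum.inr ⟨i, _⟩)) => esPx k r i

/-- The family obtained by solving the defining equations of `esFam` for the indeterminates. -/
def esInv (k r : ℕ) : EvenSphereVar k r → EvenSphereRing k r := fun v =>
  match v with
  | Sum.inl _ => MvPolynomial.C (-1 / 8) * esA k r + MvPolynomial.C (3 / 64) * esE k r ^ 2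
  | Sum.inr (Sum.inl ⟨i, _⟩) =>
      MvPolynomial.C (1 / 2) * esP k r i - MvPolynomial.C (1 / 8) * (esE k r * esPx k r i)
  | Sum.inr (Sum.inr (Sum.inl _)) => MvPolynomial.C (1 / 4) * esE k r
  | Sum.inr (Sum.inr (Sum.inr ⟨i, _⟩)) => esPx k r i

section Substitution

variable {k r : ℕ} (f : EvenSphereVar k r → EvenSphereRing k r)

lemma aeval_esA : MvPolynomial.aeval f (esA k r) = f (Sum.inl ()) := by
  simp [esA]

lemma aeval_esE : MvPolynomial.aeval f (esE k r) = f (Sum.inr (Sum.inr (Sum.inl ()))) := by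
  simp [esE]

lemma aeval_esP {i : ℕ} (h : 1 ≤ i ∧ i ≤ k - 1) :
    MvPolynomial.aeval f (esP k r i) = f (Sum.inr (Sum.inl ⟨i, h⟩)) := by
  simp [esP, h]

lemma aeval_esPx (hf : ∀ i h, f (Sum.inr (Sum.inr (Sum.inr ⟨i, h⟩))) = esPx k r i) (i : ℕ) :
    MvPolynomial.aeval f (esPx k r i) = esPx k r i := by
  by_cases h : r ≤ i ∧ i ≤ k - 1
  · rw [esPx, dif_pos h, MvPolynomial.aeval_X, hf, esPx, dif_pos h]
  · simp [esPx, h]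

end Substitution

lemma esX_eq (k r : ℕ) (v : EvenSphereVar k r) :
    (MvPolynomial.X v : EvenSphereRing k r) =
      match v with
      | Sum.inl _ => esA k r
      | Sum.inr (Sum.inl ⟨i, _⟩) => esP k r i
      | Sum.inr (Sum.inr (Sum.inl _)) => esE k r
      | Sum.inr (Sum.inr (Sum.inr ⟨i, _⟩)) => esPx k r i := by
  rcases v with _ | ⟨i, h⟩ | _ | ⟨i, h⟩ <;> simp [esA, esP, esE, esPx, *]

lemma aeval_esInv_esFam (k r : ℕ) (v : EvenSphereVar k r) :
    MvPolynomial.aeval (esInv k r) (esFam k r v) = MvPolynomial.X v := by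
  have hx := aeval_esPx (esInv k r) fun _ _ => rfl
  rw [esX_eq]
  rcases v with _ | ⟨i, h⟩ | _ | ⟨i, h⟩
  · simp only [esFam, map_add, map_mul, map_neg, map_pow, map_ofNat, aeval_esA, aeval_esE, esInv]
    simp only [← MvPolynomial.algebraMap_eq]
    algebra
  · simp only [esFam, map_add, map_mul, map_ofNat, aeval_esP _ h, aeval_esE, hx, esInv]
    simp only [← MvPolynomial.algebraMap_eq]
    algebra
  · simp only [esFam, map_mul, map_ofNat, aeval_esE, esInv]
    simp only [← MvPolynomial.algebraMap_eq]
    algebra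
  · exact hx i

lemma aeval_esFam_esInv (k r : ℕ) (v : EvenSphereVar k r) :
    MvPolynomial.aeval (esFam k r) (esInv k r v) = MvPolynomial.X v := by
  have hx := aeval_esPx (esFam k r) fun _ _ => rfl
  rw [esX_eq]
  rcases v with _ | ⟨i, h⟩ | _ | ⟨i, h⟩
  · simp only [esInv, map_add, map_mul, map_pow, MvPolynomial.algHom_C, aeval_esA, aeval_esE, esFam]
    algebra
  · simp only [esInv, map_sub, map_mul, MvPolynomial.algHom_C, aeval_esP _ h, aeval_esE, hx, esFam]
    algebra
  · simp only [esInv, map_mul, MvPolynomial.algHom_C, aeval_esE, esFam]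
    algebra
  · exact hx i

theorem stmt1 (k r : ℕ) (hk : 1 ≤ k)
    (hr : k < 2 * r) (hrmin : ∀ s : ℕ, k < 2 * s → r ≤ s) :
    AlgebraicIndependent ℚ (esFam k r) ∧
    Algebra.adjoin ℚ (Set.range (esFam k r)) = ⊤ := by
  constructor
  · refine Function.LeftInverse.injective (g := MvPolynomial.aeval (esInv k r)) fun p => ?_
    have h : (MvPolynomial.aeval (esInv k r)).comp (MvPolynomial.aeval (esFam k r)) =
        AlgHom.id ℚ (EvenSphereRing k r) :=
      MvPolynomial.algHom_ext fun v => by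
        rw [AlgHom.comp_apply, MvPolynomial.aeval_X, aeval_esInv_esFam, AlgHom.id_apply]
    exact DFunLike.congr_fun h p
  · rw [Algebra.adjoin_range_eq_range_aeval, AlgHom.range_eq_top]
    refine Function.RightInverse.surjective (g := MvPolynomial.aeval (esInv k r)) fun p => ?_
    have h : (MvPolynomial.aeval (esFam k r)).comp (MvPolynomial.aeval (esInv k r)) =
        AlgHom.id ℚ (EvenSphereRing k r) :=
      MvPolynomial.algHom_ext fun v => by
        rw [AlgHom.comp_apply, MvPolynomial.aeval_X, aeval_esFam_esInv, AlgHom.id_apply]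
    exact DFunLike.congr_fun h p

end
end

section
/- Let n ≥ 1, let A be a commutative ℚ-algebra, let t ∈ A and let a₂, …, a_{n+1} ∈ A; set a₀ = 1 and a₁ = 0. Define c_i = Σ_{j=0}^{i} C(n+1−i+j, j)·a_{i−j}·t^j for 0 ≤ i ≤ n+1, where C(m, j) denotes the binomial coefficient. Then c₁ = (n+1)·t, and for every 0 ≤ i ≤ n+1 one has a_i = Σ_{j=0}^{i} (−1)^j·C(n+1−i+j, j)·c_{i−j}·t^j. -/
/-!
Statement 2: inversion formula relating the classes aᵢ and
cᵢ = Σ_{j=0}^{i} C(n+1−i+j, j)·a_{i−j}·t^j in a commutative ℚ-algebra: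
c₁ = (n+1)t and aᵢ = Σ_{j=0}^{i} (−1)^j·C(n+1−i+j, j)·c_{i−j}·t^j for i ≤ n+1.
-/

theorem choose_add_mul_choose_add (M j k : ℕ) :
    (M + j).choose j * (M + j + k).choose k = (M + (j + k)).choose (j + k) * (j + k).choose j := by
  have h := Nat.choose_mul (n := M + j + k) (k := j + k) (s := k) (by omega)
  rw [show M + j + k - k = M + j by omega, show j + k - k = j by omega,
    ← Nat.choose_symm_add] at h
  rw [← add_assoc, h, mul_comm]

/-- The alternating sum of the products of binomial coefficients that arises when composing
the two transformations. -/
theorem sum_neg_one_pow_mul_choose_mul_choose {A : Type*} [CommRing A] (M m : ℕ) :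
    ∑ j ∈ Finset.range (m + 1),
      (-1 : A) ^ j * ((M + j).choose j : A) * ((M + m).choose (m - j) : A) =
        if m = 0 then 1 else 0 := by
  have key : ∀ j ∈ Finset.range (m + 1),
      (-1 : A) ^ j * ((M + j).choose j : A) * ((M + m).choose (m - j) : A) =
        ((M + m).choose m : A) * (((-1) ^ j * (m.choose j : ℤ) : ℤ) : A) := by
    intro j hj
    obtain ⟨k, rfl⟩ := Nat.exists_eq_add_of_le (Finset.mem_range_succ_iff.mp hj)
    have h := congrArg (Nat.cast (R := A)) (choose_add_mul_choose_add M j k)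
    rw [add_assoc M j k] at h
    push_cast at h ⊢
    rw [Nat.add_sub_cancel_left, mul_assoc, h]
    ring
  rw [Finset.sum_congr rfl key, ← Finset.mul_sum, ← Int.cast_sum,
    Int.alternating_sum_range_choose]
  split_ifs with hm <;> simp [hm]

theorem stmt2 (n : ℕ) (hn : 1 ≤ n) (A : Type*) [CommRing A] [Algebra ℚ A]
    (t : A) (a : ℕ → A) (ha0 : a 0 = 1) (ha1 : a 1 = 0)
    (c : ℕ → A)
    (hc : ∀ i : ℕ, c i =
      ∑ j ∈ Finset.range (i + 1), ((n + 1 - i + j).choose j : A) * a (i - j) * t ^ j) :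
    c 1 = ((n : A) + 1) * t ∧
    ∀ i : ℕ, i ≤ n + 1 →
      a i = ∑ j ∈ Finset.range (i + 1),
        (-1 : A) ^ j * ((n + 1 - i + j).choose j : A) * c (i - j) * t ^ j := by
  constructor
  · simp [hc, Finset.sum_range_succ, ha0, ha1]
  intro i hi
  obtain ⟨M, hM⟩ := Nat.exists_eq_add_of_le' hi
  have hMi : n + 1 - i = M := by omega
  have hexp : ∀ j ∈ Finset.range (i + 1),
      (-1 : A) ^ j * ((n + 1 - i + j).choose j : A) * c (i - j) * t ^ j =
        ∑ k ∈ Finset.range (i + 1 - j), (-1 : A) ^ j * ((M + j).choose j : A) *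
          ((M + (j + k)).choose k : A) * (a (i - (j + k)) * t ^ (j + k)) := by
    intro j hj
    have hji := Finset.mem_range_succ_iff.mp hj
    rw [hMi, hc, Nat.sub_add_comm hji, Finset.mul_sum, Finset.sum_mul]
    refine Finset.sum_congr rfl fun k _ => ?_
    rw [show n + 1 - (i - j) + k = M + (j + k) by omega, Nat.sub_sub, pow_add]
    ring
  rw [Finset.sum_congr rfl hexp, ← Finset.sum_range_diag_flip (i + 1) fun j k =>
    (-1 : A) ^ j * ((M + j).choose j : A) *
      ((M + (j + k)).choose k : A) * (a (i - (j + k)) * t ^ (j + k))]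
  have hdiag : ∀ m ∈ Finset.range (i + 1),
      ∑ j ∈ Finset.range (m + 1), (-1 : A) ^ j * ((M + j).choose j : A) *
        ((M + (j + (m - j))).choose (m - j) : A) *
          (a (i - (j + (m - j))) * t ^ (j + (m - j))) =
        if m = 0 then a i else 0 := by
    intro m _
    have hsum := sum_neg_one_pow_mul_choose_mul_choose (A := A) M m
    rw [Finset.sum_congr rfl (g := fun j => (-1 : A) ^ j * ((M + j).choose j : A) *
      ((M + m).choose (m - j) : A) * (a (i - m) * t ^ m)) fun j hj => by
        rw [Nat.add_sub_cancel' (Finset.mem_range_succ_iff.mp hj)],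
      ← Finset.sum_mul, hsum]
    split_ifs with hm <;> simp [hm]
  rw [Finset.sum_congr rfl hdiag]
  simp
end

section
/- Let n ≥ 1, let A be a commutative ℚ-algebra, let t ∈ A and let a₂, …, a_{n+1} ∈ A; set a₀ = 1 and a₁ = 0. Define c_i = Σ_{j=0}^{i} C(n+1−i+j, j)·a_{i−j}·t^j for 0 ≤ i ≤ n+1, where C(m, j) denotes the binomial coefficient. Then for every y ∈ A and every 0 ≤ i ≤ n+1 one has Σ_{j=0}^{i} C(n+1−i+j, j)·c_{i−j}·(y−t)^j = Σ_{m=0}^{i} C(n+1−i+m, m)·a_{i−m}·y^m. -/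
/-!
Statement 3: for cᵢ = Σ_{j=0}^{i} C(n+1−i+j, j)·a_{i−j}·t^j in a commutative
ℚ-algebra, substituting y − t yields
Σ_{j=0}^{i} C(n+1−i+j, j)·c_{i−j}·(y−t)^j = Σ_{m=0}^{i} C(n+1−i+m, m)·a_{i−m}·y^m
for all y and all 0 ≤ i ≤ n+1.
-/

theorem choose_mul_choose_add (N j k : ℕ) :
    (N + j).choose j * (N + j + k).choose k = (N + (j + k)).choose (j + k) * (j + k).choose j := by
  have h := Nat.choose_mul (n := N + j + k) (k := j + k) (s := k) (by omega)
  rw [Nat.choose_symm_add, ← add_assoc, h, Nat.add_sub_cancel, Nat.add_sub_cancel, mul_comm]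

theorem stmt3 (n : ℕ) (hn : 1 ≤ n) (A : Type*) [CommRing A] [Algebra ℚ A]
    (t : A) (a : ℕ → A) (ha0 : a 0 = 1) (ha1 : a 1 = 0)
    (c : ℕ → A)
    (hc : ∀ i : ℕ, c i =
      ∑ j ∈ Finset.range (i + 1), ((n + 1 - i + j).choose j : A) * a (i - j) * t ^ j) :
    ∀ y : A, ∀ i : ℕ, i ≤ n + 1 →
      ∑ j ∈ Finset.range (i + 1),
          ((n + 1 - i + j).choose j : A) * c (i - j) * (y - t) ^ j =
        ∑ m ∈ Finset.range (i + 1),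
          ((n + 1 - i + m).choose m : A) * a (i - m) * y ^ m := by
  intro y i hi
  obtain ⟨N, hN⟩ := Nat.exists_eq_add_of_le' hi
  have hsub : n + 1 - i = N := by omega
  rw [hsub]
  let F : ℕ → ℕ → A := fun j k =>
    ((N + j).choose j : A) * ((N + j + k).choose k : A) * a (i - (j + k)) * (y - t) ^ j * t ^ k
  have hl : ∀ j ∈ Finset.range (i + 1),
      ((N + j).choose j : A) * c (i - j) * (y - t) ^ j =
        ∑ k ∈ Finset.range (i + 1 - j), F j k := by
    intro j hj
    have hj : j ≤ i := by simpa [Nat.lt_succ_iff] using hj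
    rw [hc, show n + 1 - (i - j) = N + j by omega, show i - j + 1 = i + 1 - j by omega,
      Finset.mul_sum, Finset.sum_mul]
    refine Finset.sum_congr rfl fun k _ => ?_
    simp only [F, Nat.sub_sub]
    ring
  rw [Finset.sum_congr rfl hl, ← Finset.sum_range_diag_flip]
  refine Finset.sum_congr rfl fun m _ => ?_
  conv_rhs => rw [← sub_add_cancel y t, add_pow, Finset.mul_sum]
  refine Finset.sum_congr rfl fun j hj => ?_
  obtain ⟨k, rfl⟩ := Nat.exists_eq_add_of_le (Nat.lt_succ_iff.mp (Finset.mem_range.mp hj))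
  have h := congrArg (Nat.cast : ℕ → A) (choose_mul_choose_add N j k)
  push_cast at h
  simp only [F, Nat.add_sub_cancel_left]
  rw [h]
  ring
end

section
/- Let n ≥ 1, let A be the polynomial ring over ℚ in indeterminates a₂, …, a_{n+1} (with the conventions a₀ = 1, a₁ = 0), let f = x^{n+1} + Σ_{j=2}^{n+1} a_j x^{n+1−j} ∈ A[x], let B = A[x]/(f), which is free as an A-module with basis 1, x, …, x^n, let π_! : B → A be the A-linear map taking the coefficient of x^n in this basis, and let 𝔞 ⊆ A be the ideal generated by a₂, …, a_{n+1}. Then: π_!(x^n) = 1; for every 1 ≤ k ≤ n+1 one has π_!(x^{n+k}) + a_k ∈ 𝔞²; and for every k > n+1 one has π_!(x^{n+k}) ∈ 𝔞². -/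
/-!
Statement 4: pushforwards of powers of the coupling class.
A = ℚ[a₂,…,a_{n+1}], B = A[x]/(x^{n+1} + a₂x^{n−1} + ⋯ + a_{n+1}) free over A with
basis 1, x, …, x^n, π_! : B → A the coefficient of x^n.  Then π_!(x^n) = 1,
π_!(x^{n+k}) + a_k ∈ 𝔞² for 1 ≤ k ≤ n+1, and π_!(x^{n+k}) ∈ 𝔞² for k > n+1,
where 𝔞 = (a₂,…,a_{n+1}).
-/

noncomputable section

open Polynomial

/-- The polynomial ring A = ℚ[a₂,…,a_{n+1}]. -/
abbrev ARing (n : ℕ) : Type := MvPolynomial {j : ℕ // 2 ≤ j ∧ j ≤ n + 1} ℚ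

/-- The element a_j, with conventions a₀ = 1, a₁ = 0 (and a_j = 0 for j > n+1). -/
def aGen (n : ℕ) (j : ℕ) : ARing n :=
  if j = 0 then 1 else if h : 2 ≤ j ∧ j ≤ n + 1 then MvPolynomial.X ⟨j, h⟩ else 0

/-- The monic polynomial f = x^{n+1} + Σ_{j=2}^{n+1} a_j x^{n+1−j}. -/
def fPoly (n : ℕ) : Polynomial (ARing n) :=
  X ^ (n + 1) + ∑ j ∈ Finset.Icc 2 (n + 1), C (aGen n j) * X ^ (n + 1 - j)

/-- π_! : B = A[x]/(f) → A, the A-linear functional extracting the coefficient of x^n in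
the basis 1, x, …, x^n; computed on the canonical representative modulo the monic f. -/
def piShriek (n : ℕ) (g : Polynomial (ARing n)) : ARing n := (g %ₘ fPoly n).coeff n

/-- The ideal 𝔞 = (a₂,…,a_{n+1}) ⊆ A. -/
def aIdeal (n : ℕ) : Ideal (ARing n) :=
  Ideal.span {x : ARing n | ∃ j : ℕ, 2 ≤ j ∧ j ≤ n + 1 ∧ x = aGen n j}

theorem fPoly_monic_and_degree (n : ℕ) : (fPoly n).Monic ∧ (fPoly n).degree = (n + 1 : ℕ) := by
  have hd : (∑ j ∈ Finset.Icc 2 (n + 1), C (aGen n j) * X ^ (n + 1 - j)).degree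
      < ((n + 1 : ℕ) : WithBot ℕ) := by
    refine lt_of_le_of_lt (degree_sum_le _ _) ((Finset.sup_lt_iff (WithBot.bot_lt_coe _)).2 ?_)
    intro j hj
    rw [Finset.mem_Icc] at hj
    refine lt_of_le_of_lt (degree_C_mul_X_pow_le _ _) ?_
    exact_mod_cast (by omega : n + 1 - j < n + 1)
  refine ⟨monic_X_pow_add hd, ?_⟩
  rw [fPoly, degree_add_eq_left_of_degree_lt (by rwa [degree_X_pow]), degree_X_pow]

/-- The pushforward as a linear functional on polynomials. -/
def piShriekLinear (n : ℕ) : Polynomial (ARing n) →ₗ[ARing n] ARing n :=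
  (lcoeff (ARing n) n).comp (modByMonicHom (fPoly n))

theorem piShriekLinear_apply (n : ℕ) (g : Polynomial (ARing n)) :
    piShriekLinear n g = piShriek n g := rfl

theorem piShriek_X_pow_of_le {n i : ℕ} (hi : i ≤ n) :
    piShriek n (X ^ i) = if i = n then 1 else 0 := by
  obtain ⟨hm, hd⟩ := fPoly_monic_and_degree n
  rw [piShriek, (modByMonic_eq_self_iff hm).2, coeff_X_pow]
  · simp only [eq_comm]
  · rw [hd, degree_X_pow]
    exact_mod_cast Nat.lt_succ_of_le hi

theorem piShriek_X_pow_recurrence (n : ℕ) {k : ℕ} (hk : 1 ≤ k) :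
    piShriek n (X ^ (n + k)) =
      -∑ j ∈ Finset.Icc 2 (n + 1), aGen n j * piShriek n (X ^ (n + k - j)) := by
  have h0 : piShriek n (fPoly n * X ^ (k - 1)) = 0 := by
    rw [piShriek, (modByMonic_eq_zero_iff_dvd (fPoly_monic_and_degree n).1).2 (dvd_mul_right _ _),
      coeff_zero]
  have hf : fPoly n * X ^ (k - 1) = X ^ (n + k) +
      ∑ j ∈ Finset.Icc 2 (n + 1), aGen n j • (X : Polynomial (ARing n)) ^ (n + k - j) := by
    rw [fPoly, add_mul, Finset.sum_mul, ← pow_add]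
    congr 1
    · congr 1
      omega
    · refine Finset.sum_congr rfl fun j hj => ?_
      rw [Finset.mem_Icc] at hj
      rw [mul_assoc, ← pow_add, smul_eq_C_mul]
      congr 2
      omega
  rw [hf, ← piShriekLinear_apply, map_add, map_sum] at h0
  simp only [map_smul, piShriekLinear_apply, smul_eq_mul] at h0
  exact eq_neg_of_add_eq_zero_left h0

theorem aGen_mem_aIdeal {n j : ℕ} (hj : j ∈ Finset.Icc 2 (n + 1)) : aGen n j ∈ aIdeal n :=
  Ideal.subset_span ⟨j, (Finset.mem_Icc.1 hj).1, (Finset.mem_Icc.1 hj).2, rfl⟩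

theorem piShriek_X_pow_sub_mem (n i : ℕ) :
    piShriek n (X ^ i) - (if i = n then 1 else 0) ∈ aIdeal n := by
  rcases le_or_gt i n with hi | hi
  · rw [piShriek_X_pow_of_le hi, sub_self]
    exact zero_mem _
  · obtain ⟨k, rfl⟩ := Nat.exists_eq_add_of_le hi.le
    rw [if_neg hi.ne', sub_zero, piShriek_X_pow_recurrence n (by omega)]
    exact neg_mem (sum_mem fun j hj => Ideal.mul_mem_right _ _ (aGen_mem_aIdeal hj))

theorem aGen_eq_zero {n k : ℕ} (hk : 1 ≤ k) (h : k ∉ Finset.Icc 2 (n + 1)) : aGen n k = 0 := by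
  rw [Finset.mem_Icc] at h
  rw [aGen, if_neg (by omega), dif_neg h]

theorem piShriek_X_pow_add_aGen_mem (n : ℕ) {k : ℕ} (hk : 1 ≤ k) :
    piShriek n (X ^ (n + k)) + aGen n k ∈ aIdeal n ^ 2 := by
  have ha : aGen n k = ∑ j ∈ Finset.Icc 2 (n + 1),
      aGen n j * (if n + k - j = n then 1 else 0) := by
    have hs : ∀ j ∈ Finset.Icc 2 (n + 1), aGen n j * (if n + k - j = n then 1 else 0) =
        if k = j then aGen n j else 0 := by
      intro j hj
      rw [Finset.mem_Icc] at hj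
      rw [mul_ite, mul_one, mul_zero]
      exact if_congr (by omega) rfl rfl
    rw [Finset.sum_congr rfl hs, Finset.sum_ite_eq]
    split_ifs with h
    · rfl
    · exact aGen_eq_zero hk h
  have he : piShriek n (X ^ (n + k)) + aGen n k = -∑ j ∈ Finset.Icc 2 (n + 1),
      aGen n j * (piShriek n (X ^ (n + k - j)) - (if n + k - j = n then 1 else 0)) := by
    simp only [mul_sub, Finset.sum_sub_distrib]
    rw [← ha, piShriek_X_pow_recurrence n hk]
    ring
  rw [he, sq]
  exact neg_mem (sum_mem fun j hj =>
    Ideal.mul_mem_mul (aGen_mem_aIdeal hj) (piShriek_X_pow_sub_mem n _))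

theorem stmt4 (n : ℕ) (hn : 1 ≤ n) :
    piShriek n (X ^ n) = 1 ∧
    (∀ k : ℕ, 1 ≤ k → k ≤ n + 1 →
      piShriek n (X ^ (n + k)) + aGen n k ∈ aIdeal n ^ 2) ∧
    (∀ k : ℕ, n + 1 < k → piShriek n (X ^ (n + k)) ∈ aIdeal n ^ 2) := by
  refine ⟨?_, fun k hk _ => piShriek_X_pow_add_aGen_mem n hk, fun k hk => ?_⟩
  · rw [piShriek_X_pow_of_le le_rfl, if_pos rfl]
  · have h := piShriek_X_pow_add_aGen_mem n (k := k) (by omega)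
    rwa [aGen_eq_zero (by omega) (by rw [Finset.mem_Icc]; omega), add_zero] at h

end
end

section
/- Let n ≥ 1, N ≥ 1, let r₁, …, r_N be integers with 1 ≤ r_i ≤ n, and let λ₁, …, λ_N ∈ ℚ. Let R be the polynomial ring over ℚ in the indeterminates a₂, …, a_{n+1} together with p_{i|j} for 1 ≤ i ≤ N, 0 ≤ j < r_i. Let f = x^{n+1} + Σ_{j=2}^{n+1} a_j x^{n+1−j} ∈ R[x], let B = R[x]/(f), free as an R-module with basis 1, x, …, x^n, let π_! : B → R take the coefficient of x^n in this basis, and set P_i = λ_i·x^{r_i} + Σ_{j=0}^{r_i−1} p_{i|j}·x^j ∈ B. Then the n + (r₁ + ⋯ + r_N) elements π_!(x^{n+2}), …, π_!(x^{2n+1}) together with π_!(x^ℓ·P_i) for 1 ≤ i ≤ N and n−r_i+1 ≤ ℓ ≤ n are algebraically independent over ℚ and generate R as a ℚ-algebra. -/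
/-!
Statement 6: extended tautological classes for orientable ξ-fibrations over ℂPⁿ.
R = ℚ[a₂,…,a_{n+1}, p_{i|j} (1 ≤ i ≤ N, 0 ≤ j < rᵢ)],
B = R[x]/(x^{n+1} + a₂x^{n−1} + ⋯ + a_{n+1}) free over R with basis 1,…,x^n,
π_! the coefficient of x^n, P_i = λᵢx^{rᵢ} + Σ_{j<rᵢ} p_{i|j}x^j.
The n + Σᵢ rᵢ elements π_!(x^{n+2}),…,π_!(x^{2n+1}) and π_!(x^ℓ·P_i)
(1 ≤ i ≤ N, n−rᵢ+1 ≤ ℓ ≤ n) are algebraically independent over ℚ and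
generate R as a ℚ-algebra.
-/

noncomputable section

open Polynomial

/-- Index type for the indeterminates a₂,…,a_{n+1} and p_{i|j} (1 ≤ i ≤ N, 0 ≤ j < rᵢ). -/
abbrev XiVar (n N : ℕ) (r : ℕ → ℕ) : Type :=
  {j : ℕ // 2 ≤ j ∧ j ≤ n + 1} ⊕ {ij : ℕ × ℕ // 1 ≤ ij.1 ∧ ij.1 ≤ N ∧ ij.2 < r ij.1}

/-- The polynomial ring R = ℚ[a₂,…,a_{n+1}, p_{i|j}]. -/
abbrev XiRing (n N : ℕ) (r : ℕ → ℕ) : Type := MvPolynomial (XiVar n N r) ℚ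

/-- The element a_j, with conventions a₀ = 1, a₁ = 0. -/
def xa (n N : ℕ) (r : ℕ → ℕ) (j : ℕ) : XiRing n N r :=
  if j = 0 then 1 else
  if h : 2 ≤ j ∧ j ≤ n + 1 then MvPolynomial.X (Sum.inl ⟨j, h⟩) else 0

/-- The indeterminate p_{i|j}. -/
def xp (n N : ℕ) (r : ℕ → ℕ) (i j : ℕ) : XiRing n N r :=
  if h : 1 ≤ i ∧ i ≤ N ∧ j < r i then MvPolynomial.X (Sum.inr ⟨(i, j), h⟩) else 0

/-- The monic polynomial f = x^{n+1} + Σ_{j=2}^{n+1} a_j x^{n+1−j}. -/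
def xf (n N : ℕ) (r : ℕ → ℕ) : Polynomial (XiRing n N r) :=
  X ^ (n + 1) + ∑ j ∈ Finset.Icc 2 (n + 1), C (xa n N r j) * X ^ (n + 1 - j)

/-- π_! : B = R[x]/(f) → R, extracting the coefficient of x^n in the basis 1, x, …, x^n;
computed on the canonical representative modulo the monic f. -/
def xpi (n N : ℕ) (r : ℕ → ℕ) (g : Polynomial (XiRing n N r)) : XiRing n N r :=
  (g %ₘ xf n N r).coeff n

/-- The element P_i = λᵢ·x^{rᵢ} + Σ_{j=0}^{rᵢ−1} p_{i|j}·x^j of B. -/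
def xP (n N : ℕ) (r : ℕ → ℕ) (lam : ℕ → ℚ) (i : ℕ) : Polynomial (XiRing n N r) :=
  C (MvPolynomial.C (lam i)) * X ^ (r i) +
    ∑ j ∈ Finset.range (r i), C (xp n N r i j) * X ^ j

/-- The family of the n + (r₁ + ⋯ + r_N) elements π_!(x^{n+2}), …, π_!(x^{2n+1})
and π_!(x^ℓ·P_i) for 1 ≤ i ≤ N, n−rᵢ+1 ≤ ℓ ≤ n. -/
def xFam (n N : ℕ) (r : ℕ → ℕ) (lam : ℕ → ℚ) :
    (Fin n ⊕ {il : ℕ × ℕ // 1 ≤ il.1 ∧ il.1 ≤ N ∧ n - r il.1 + 1 ≤ il.2 ∧ il.2 ≤ n}) →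
      XiRing n N r := fun v =>
  match v with
  | Sum.inl m => xpi n N r (X ^ (n + 2 + (m : ℕ)))
  | Sum.inr ⟨(i, l), _⟩ => xpi n N r (X ^ l * xP n N r lam i)

/-- A surjective endomorphism of a noetherian commutative ring is injective. -/
theorem RingHom.injective_of_surjective_of_isNoetherianRing {A : Type*} [CommRing A]
    [IsNoetherianRing A] (φ : A →+* A) (hφ : Function.Surjective φ) : Function.Injective φ := by
  have hmono : Monotone fun k : ℕ => RingHom.ker (φ ^ k) := by
    refine monotone_nat_of_le_succ fun k x hx => ?_
    rw [RingHom.mem_ker] at hx ⊢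
    rw [pow_succ', RingHom.mul_def, RingHom.comp_apply, hx, map_zero]
  obtain ⟨k, hk⟩ := monotone_stabilizes_iff_noetherian.mpr ‹IsNoetherianRing A› ⟨_, hmono⟩
  rw [injective_iff_map_eq_zero]
  intro x hx
  obtain ⟨y, rfl⟩ : ∃ y, (φ ^ k) y = x := by
    rw [RingHom.coe_pow]
    exact hφ.iterate k x
  have hy : y ∈ RingHom.ker (φ ^ (k + 1)) := by
    rwa [RingHom.mem_ker, pow_succ', RingHom.mul_def, RingHom.comp_apply]
  have hker : RingHom.ker (φ ^ k) = RingHom.ker (φ ^ (k + 1)) := hk (k + 1) k.le_succ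
  rwa [← hker, RingHom.mem_ker] at hy

/-- A generating family of a polynomial ring in finitely many variables, with as many members as
there are variables, is algebraically independent. -/
theorem MvPolynomial.algebraicIndependent_of_adjoin_range_eq_top {σ ι K : Type*} [CommRing K]
    [IsNoetherianRing K] [Finite ι] (e : ι ≃ σ) (v : ι → MvPolynomial σ K)
    (hv : Algebra.adjoin K (Set.range v) = ⊤) : AlgebraicIndependent K v := by
  let ψ : MvPolynomial ι K →ₐ[K] MvPolynomial ι K :=
    ((renameEquiv K e).symm : MvPolynomial σ K →ₐ[K] MvPolynomial ι K).comp (aeval v)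
  have hsurj : Function.Surjective (aeval v : MvPolynomial ι K →ₐ[K] MvPolynomial σ K) := by
    rw [← AlgHom.range_eq_top, ← Algebra.adjoin_range_eq_range_aeval, hv]
  have hψ : Function.Surjective (ψ : MvPolynomial ι K →+* MvPolynomial ι K) :=
    (renameEquiv K e).symm.surjective.comp hsurj
  have hinj : Function.Injective ((renameEquiv K e).symm ∘ aeval v) :=
    RingHom.injective_of_surjective_of_isNoetherianRing _ hψ
  exact hinj.of_comp

section GysinMap

variable {n N : ℕ} {r : ℕ → ℕ}

theorem degree_xf_tail_lt :
    (∑ j ∈ Finset.Icc 2 (n + 1), C (xa n N r j) * X ^ (n + 1 - j)).degree <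
      ((n + 1 : ℕ) : WithBot ℕ) := by
  refine (degree_sum_le _ _).trans_lt ?_
  rw [Finset.sup_lt_iff (WithBot.bot_lt_coe _)]
  intro j hj
  rw [Finset.mem_Icc] at hj
  refine (degree_C_mul_X_pow_le _ _).trans_lt ?_
  exact_mod_cast (show n + 1 - j < n + 1 by omega)

theorem xf_monic : (xf n N r).Monic :=
  monic_X_pow_add degree_xf_tail_lt

theorem xf_degree : (xf n N r).degree = (n + 1 : ℕ) := by
  rw [xf, degree_add_eq_left_of_degree_lt, degree_X_pow]
  rw [degree_X_pow]
  exact degree_xf_tail_lt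

theorem xpi_add (g h : (XiRing n N r)[X]) :
    xpi n N r (g + h) = xpi n N r g + xpi n N r h := by
  simp [xpi, add_modByMonic]

theorem xpi_C_mul (c : XiRing n N r) (g : (XiRing n N r)[X]) :
    xpi n N r (C c * g) = c * xpi n N r g := by
  simp [xpi, ← smul_eq_C_mul, smul_modByMonic]

theorem xpi_sum {ι : Type*} (s : Finset ι) (g : ι → (XiRing n N r)[X]) :
    xpi n N r (∑ i ∈ s, g i) = ∑ i ∈ s, xpi n N r (g i) := by
  classical
  induction s using Finset.induction_on with
  | empty => simp [xpi]
  | insert a s ha ih => rw [Finset.sum_insert ha, Finset.sum_insert ha, xpi_add, ih]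

theorem xpi_X_pow_of_le {k : ℕ} (hk : k ≤ n) : xpi n N r (X ^ k) = if k = n then 1 else 0 := by
  rw [xpi, (modByMonic_eq_self_iff xf_monic).mpr, coeff_X_pow]
  · simp [eq_comm]
  · rw [xf_degree, degree_X_pow]
    exact_mod_cast Nat.lt_succ_of_le hk

/-- The recurrence for the classes `π_!(x^{n+m})` given by multiples of `f`. -/
theorem xpi_X_pow_add_succ (m : ℕ) :
    xpi n N r (X ^ (n + 1 + m)) =
      -∑ j ∈ Finset.Icc 2 (n + 1), xa n N r j * xpi n N r (X ^ (n + 1 - j + m)) := by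
  have h0 : xpi n N r (xf n N r * X ^ m) = 0 := by
    rw [xpi, self_mul_modByMonic xf_monic, coeff_zero]
  rw [xf, add_mul, Finset.sum_mul, ← pow_add, xpi_add, xpi_sum] at h0
  simp only [mul_assoc, ← pow_add, xpi_C_mul] at h0
  exact eq_neg_of_add_eq_zero_left h0

theorem xpi_X_pow_mem (S : Subalgebra ℚ (XiRing n N r))
    (hS : ∀ m < n, xpi n N r (X ^ (n + 2 + m)) ∈ S) {k : ℕ} (hk : k ≤ 2 * n + 1) :
    xpi n N r (X ^ k) ∈ S := by
  rcases le_or_gt k n with h | h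
  · rw [xpi_X_pow_of_le h]
    split_ifs
    · exact S.one_mem
    · exact S.zero_mem
  · rcases Nat.lt_or_ge k (n + 2) with h' | h'
    · obtain rfl : k = n + 1 + 0 := by omega
      rw [xpi_X_pow_add_succ, Finset.sum_eq_zero, neg_zero]
      · exact S.zero_mem
      · intro j hj
        rw [Finset.mem_Icc] at hj
        rw [xpi_X_pow_of_le (by omega), if_neg (by omega), mul_zero]
    · obtain ⟨m, rfl⟩ := Nat.exists_eq_add_of_le h'
      exact hS m (by omega)

theorem xa_mem (S : Subalgebra ℚ (XiRing n N r))
    (hS : ∀ m < n, xpi n N r (X ^ (n + 2 + m)) ∈ S) (j : ℕ) (hj : 2 ≤ j) (hjn : j ≤ n + 1) :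
    xa n N r j ∈ S := by
  induction j using Nat.strong_induction_on with
  | _ j ih =>
    have hrec := xpi_X_pow_add_succ (n := n) (N := N) (r := r) (j - 1)
    rw [← Finset.add_sum_erase _ _ (Finset.mem_Icc.mpr ⟨hj, hjn⟩),
      show n + 1 - j + (j - 1) = n by omega, xpi_X_pow_of_le le_rfl, if_pos rfl, mul_one] at hrec
    rw [show xa n N r j = -xpi n N r (X ^ (n + 1 + (j - 1))) -
      ∑ k ∈ (Finset.Icc 2 (n + 1)).erase j,
        xa n N r k * xpi n N r (X ^ (n + 1 - k + (j - 1))) by rw [hrec]; ring]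
    refine S.sub_mem (S.neg_mem (xpi_X_pow_mem S hS (by omega))) (S.sum_mem fun k hk => ?_)
    rw [Finset.mem_erase, Finset.mem_Icc] at hk
    rcases lt_or_gt_of_ne hk.1 with h | h
    · exact S.mul_mem (ih k h hk.2.1 hk.2.2) (xpi_X_pow_mem S hS (by omega))
    · rw [xpi_X_pow_of_le (by omega), if_neg (by omega), mul_zero]
      exact S.zero_mem

theorem xpi_X_pow_mul_xP (lam : ℕ → ℚ) (i l : ℕ) :
    xpi n N r (X ^ l * xP n N r lam i) =
      MvPolynomial.C (lam i) * xpi n N r (X ^ (r i + l)) +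
        ∑ j ∈ Finset.range (r i), xp n N r i j * xpi n N r (X ^ (j + l)) := by
  rw [mul_comm, xP, add_mul, Finset.sum_mul, xpi_add, xpi_sum]
  simp only [mul_assoc, ← pow_add, xpi_C_mul]

theorem xp_mem (S : Subalgebra ℚ (XiRing n N r))
    (hS : ∀ m < n, xpi n N r (X ^ (n + 2 + m)) ∈ S) (lam : ℕ → ℚ) {i : ℕ} (hi : r i ≤ n)
    (hP : ∀ l, n - r i + 1 ≤ l → l ≤ n → xpi n N r (X ^ l * xP n N r lam i) ∈ S)
    (j : ℕ) (hj : j < r i) : xp n N r i j ∈ S := by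
  induction hd : r i - j using Nat.strong_induction_on generalizing j with
  | _ d ih =>
    have hrec := xpi_X_pow_mul_xP (n := n) (N := N) (r := r) lam i (n - j)
    rw [← Finset.add_sum_erase _ _ (Finset.mem_range.mpr hj),
      show j + (n - j) = n by omega, xpi_X_pow_of_le le_rfl, if_pos rfl, mul_one] at hrec
    rw [show xp n N r i j = xpi n N r (X ^ (n - j) * xP n N r lam i) -
      MvPolynomial.C (lam i) * xpi n N r (X ^ (r i + (n - j))) -
      ∑ k ∈ (Finset.range (r i)).erase j, xp n N r i k * xpi n N r (X ^ (k + (n - j))) by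
        rw [hrec]; ring]
    refine S.sub_mem (S.sub_mem (hP _ (by omega) (by omega))
      (S.mul_mem (S.algebraMap_mem _) (xpi_X_pow_mem S hS (by omega))))
      (S.sum_mem fun k hk => ?_)
    rw [Finset.mem_erase, Finset.mem_range] at hk
    rcases lt_or_gt_of_ne hk.1 with h | h
    · rw [xpi_X_pow_of_le (by omega), if_neg (by omega), mul_zero]
      exact S.zero_mem
    · exact S.mul_mem (ih _ (by omega) k hk.2 rfl) (xpi_X_pow_mem S hS (by omega))

theorem adjoin_range_xFam (hr : ∀ i : ℕ, 1 ≤ i → i ≤ N → 1 ≤ r i ∧ r i ≤ n) (lam : ℕ → ℚ) :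
    Algebra.adjoin ℚ (Set.range (xFam n N r lam)) = ⊤ := by
  set S := Algebra.adjoin ℚ (Set.range (xFam n N r lam)) with hSdef
  have hmem : ∀ v, xFam n N r lam v ∈ S := fun v => Algebra.subset_adjoin ⟨v, rfl⟩
  have hS : ∀ m < n, xpi n N r (X ^ (n + 2 + m)) ∈ S := fun m hm => hmem (Sum.inl ⟨m, hm⟩)
  rw [eq_top_iff, ← MvPolynomial.adjoin_range_X, Algebra.adjoin_le_iff]
  rintro _ ⟨⟨j, hj⟩ | ⟨⟨i, j⟩, hij⟩, rfl⟩
  · have := xa_mem S hS j hj.1 hj.2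
    rwa [xa, if_neg (by omega), dif_pos hj] at this
  · have := xp_mem S hS lam (hr i hij.1 hij.2.1).2
      (fun l hl hln => hmem (Sum.inr ⟨(i, l), hij.1, hij.2.1, hl, hln⟩)) j hij.2.2
    rwa [xp, dif_pos hij] at this

end GysinMap

/-- The bijection between the index set of the family and the set of indeterminates. -/
def xiVarEquiv (n N : ℕ) (r : ℕ → ℕ) (hr : ∀ i : ℕ, 1 ≤ i → i ≤ N → 1 ≤ r i ∧ r i ≤ n) :
    (Fin n ⊕ {il : ℕ × ℕ // 1 ≤ il.1 ∧ il.1 ≤ N ∧ n - r il.1 + 1 ≤ il.2 ∧ il.2 ≤ n}) ≃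
      XiVar n N r :=
  Equiv.sumCongr
    { toFun := fun m => ⟨m + 2, by omega⟩
      invFun := fun j => ⟨j.1 - 2, by have := j.2; omega⟩
      left_inv := fun m => by simp
      right_inv := fun j => Subtype.ext (by have := j.2; dsimp only; omega) }
    { toFun := fun il => ⟨(il.1.1, n - il.1.2), by
        obtain ⟨⟨i, l⟩, h1, h2, h3, h4⟩ := il
        have := hr i h1 h2
        refine ⟨h1, h2, (?_ : n - l < r i)⟩
        dsimp only at h3 h4
        omega⟩
      invFun := fun ij => ⟨(ij.1.1, n - ij.1.2), by
        obtain ⟨⟨i, j⟩, h1, h2, h3⟩ := ij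
        have := hr i h1 h2
        refine ⟨h1, h2, (?_ : n - r i + 1 ≤ n - j ∧ n - j ≤ n)⟩
        dsimp only at h3
        omega⟩
      left_inv := by
        rintro ⟨⟨i, l⟩, h1, h2, h3, h4⟩
        dsimp only at h4
        simp only [Subtype.mk.injEq, Prod.mk.injEq, true_and]
        omega
      right_inv := by
        rintro ⟨⟨i, j⟩, h1, h2, h3⟩
        have := hr i h1 h2
        dsimp only at h3
        simp only [Subtype.mk.injEq, Prod.mk.injEq, true_and]
        omega }

theorem stmt6 (n N : ℕ) (hn : 1 ≤ n) (hN : 1 ≤ N)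
    (r : ℕ → ℕ) (hr : ∀ i : ℕ, 1 ≤ i → i ≤ N → 1 ≤ r i ∧ r i ≤ n)
    (lam : ℕ → ℚ) :
    AlgebraicIndependent ℚ (xFam n N r lam) ∧
    Algebra.adjoin ℚ (Set.range (xFam n N r lam)) = ⊤ := by
  have hfin : Finite {il : ℕ × ℕ // 1 ≤ il.1 ∧ il.1 ≤ N ∧ n - r il.1 + 1 ≤ il.2 ∧ il.2 ≤ n} :=
    ((Set.finite_Iic N).prod (Set.finite_Iic n)).subset (fun _ h => ⟨h.2.1, h.2.2.2⟩)
  have hgen := adjoin_range_xFam hr lam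
  exact ⟨MvPolynomial.algebraicIndependent_of_adjoin_range_eq_top (xiVarEquiv n N r hr) _ hgen,
    hgen⟩

end
end

section
/- Let n = 2k with k ≥ 1, let A be the polynomial ring over ℚ in indeterminates a₂, …, a_{n+1} (with a₀ = 1, a₁ = 0, and a_j = 0 for j > n+1), let f = x^{n+1} + Σ_{j=2}^{n+1} a_j x^{n+1−j} ∈ A[x], let B = A[x]/(f), free over A with basis 1, x, …, x^n, and let π_! : B → A take the coefficient of x^n in this basis. Define c_i^{fw} = Σ_{j=0}^{i} C(n+1−j, i−j)·a_j·x^{i−j} ∈ B for i ≥ 0, p_s^{fw} = Σ_{j=0}^{2s} (−1)^{j−s} c_j^{fw} c_{2s−j}^{fw} (so p₁^{fw} = (n+1)x² − 2a₂), and β_s = (n+1)^s·p_s^{fw} − C(n+1, s)·(p₁^{fw})^s for 2 ≤ s ≤ k. Let σ : A → A be the ℚ-algebra automorphism with σ(a_i) = (−1)^i·a_i for all i. Then every one of the elements π_!((p₁^{fw})^ℓ) for k+1 ≤ ℓ ≤ 2k, π_!((p₁^{fw})^{3k+1}), and π_!((p₁^{fw})^ℓ·β_s) for 2 ≤ s ≤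 k and k+s−1 ≤ ℓ ≤ 2k is fixed by σ, and together these elements generate the fixed subalgebra {p ∈ A : σ(p) = p} as a ℚ-algebra. -/
/-!
Statement 9: even n = 2k.  With A = ℚ[a₂,…,a_{n+1}],
B = A[x]/(x^{n+1} + a₂x^{n−1} + ⋯ + a_{n+1}), π_! the coefficient of x^n,
c_i^{fw} = Σ_{j=0}^{i} C(n+1−j, i−j)·a_j·x^{i−j},
p_s^{fw} = Σ_{j=0}^{2s} (−1)^{j−s} c_j^{fw} c_{2s−j}^{fw},
β_s = (n+1)^s p_s^{fw} − C(n+1,s)(p₁^{fw})^s, and σ the ℚ-algebra automorphism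
a_i ↦ (−1)^i a_i, the elements π_!((p₁^{fw})^ℓ) (k+1 ≤ ℓ ≤ 2k),
π_!((p₁^{fw})^{3k+1}) and π_!((p₁^{fw})^ℓ·β_s) (2 ≤ s ≤ k, k+s−1 ≤ ℓ ≤ 2k)
are all fixed by σ and generate the fixed subalgebra of σ as a ℚ-algebra.
-/

noncomputable section

open Polynomial

/-- The fiberwise Chern class c_i^{fw} = Σ_{j=0}^{i} C(n+1−j, i−j)·a_j·x^{i−j}. -/
def cfw (n : ℕ) (i : ℕ) : Polynomial (ARing n) :=
  ∑ j ∈ Finset.range (i + 1),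
    C ((((n + 1 - j).choose (i - j) : ℕ) : ARing n) * aGen n j) * X ^ (i - j)

/-- The fiberwise Pontryagin class p_s^{fw} = Σ_{j=0}^{2s} (−1)^{j−s} c_j^{fw} c_{2s−j}^{fw}
(so p₁^{fw} = (n+1)x² − 2a₂). -/
def psfw (n : ℕ) (s : ℕ) : Polynomial (ARing n) :=
  ∑ j ∈ Finset.range (2 * s + 1),
    (-1 : Polynomial (ARing n)) ^ (j + s) * cfw n j * cfw n (2 * s - j)

/-- The class β_s = (n+1)^s·p_s^{fw} − C(n+1, s)·(p₁^{fw})^s. -/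
def betaCl (n : ℕ) (s : ℕ) : Polynomial (ARing n) :=
  C (((n + 1 : ℕ) ^ s : ℕ) : ARing n) * psfw n s -
    C ((((n + 1).choose s : ℕ)) : ARing n) * (psfw n 1) ^ s

/-- The ℚ-algebra automorphism σ of A with σ(a_i) = (−1)^i·a_i. -/
def sigmaAut (n : ℕ) : ARing n →ₐ[ℚ] ARing n :=
  MvPolynomial.aeval fun v : {j : ℕ // 2 ≤ j ∧ j ≤ n + 1} =>
    (-1 : ARing n) ^ (v : ℕ) * MvPolynomial.X v

/-- The family of elements π_!((p₁^{fw})^ℓ) for k+1 ≤ ℓ ≤ 2k, π_!((p₁^{fw})^{3k+1}),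
and π_!((p₁^{fw})^ℓ·β_s) for 2 ≤ s ≤ k and k+s−1 ≤ ℓ ≤ 2k. -/
def evenFam (k : ℕ) :
    (Fin k ⊕ Unit ⊕
      {sl : ℕ × ℕ // 2 ≤ sl.1 ∧ sl.1 ≤ k ∧ k + sl.1 - 1 ≤ sl.2 ∧ sl.2 ≤ 2 * k}) →
      ARing (2 * k) := fun v =>
  match v with
  | Sum.inl l => piShriek (2 * k) (psfw (2 * k) 1 ^ (k + 1 + (l : ℕ)))
  | Sum.inr (Sum.inl _) => piShriek (2 * k) (psfw (2 * k) 1 ^ (3 * k + 1))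
  | Sum.inr (Sum.inr ⟨(s, l), _⟩) =>
      piShriek (2 * k) (psfw (2 * k) 1 ^ l * betaCl (2 * k) s)

/-- The weight `j` of the generator `a_j`. -/
def genWeight (n : ℕ) (v : {j : ℕ // 2 ≤ j ∧ j ≤ n + 1}) : ℕ := v

/-- The order of the generator `a_j` for the decomposability filtration: `2` if `j` is even and
`1` if `j` is odd. -/
def genOrder (n : ℕ) (v : {j : ℕ // 2 ≤ j ∧ j ≤ n + 1}) : ℕ := if Even (v : ℕ) then 2 else 1

section OrderIdeal

/-- The ideal of polynomials all of whose monomials have order at least `r`. -/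
def orderIdeal (n r : ℕ) : Ideal (ARing n) where
  carrier := {p | ∀ d, p.coeff d ≠ 0 → r ≤ Finsupp.weight (genOrder n) d}
  zero_mem' := by simp
  add_mem' := by
    intro p q hp hq d hd
    rw [MvPolynomial.coeff_add] at hd
    by_cases h : p.coeff d = 0
    · exact hq d (by simpa [h] using hd)
    · exact hp d h
  smul_mem' := by
    intro c p hp d hd
    rw [smul_eq_mul, MvPolynomial.coeff_mul] at hd
    obtain ⟨x, hx, hne⟩ := Finset.exists_ne_zero_of_sum_ne_zero hd
    have h := hp x.2 (right_ne_zero_of_mul hne)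
    rw [← Finset.HasAntidiagonal.mem_antidiagonal.1 hx, map_add]
    omega

theorem mul_mem_orderIdeal {n a b : ℕ} {p q : ARing n} (hp : p ∈ orderIdeal n a)
    (hq : q ∈ orderIdeal n b) : p * q ∈ orderIdeal n (a + b) := by
  intro d hd
  rw [MvPolynomial.coeff_mul] at hd
  obtain ⟨x, hx, hne⟩ := Finset.exists_ne_zero_of_sum_ne_zero hd
  have h1 := hp x.1 (left_ne_zero_of_mul hne)
  have h2 := hq x.2 (right_ne_zero_of_mul hne)
  rw [← Finset.HasAntidiagonal.mem_antidiagonal.1 hx, map_add]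
  omega

theorem orderIdeal_mul_le (n a b : ℕ) :
    orderIdeal n a * orderIdeal n b ≤ orderIdeal n (a + b) :=
  Ideal.mul_le.2 fun _ hp _ hq => mul_mem_orderIdeal hp hq

theorem orderIdeal_anti {n a b : ℕ} (h : a ≤ b) : orderIdeal n b ≤ orderIdeal n a :=
  fun _ hp d hd => h.trans (hp d hd)

theorem X_mem_orderIdeal {n r : ℕ} (v : {j : ℕ // 2 ≤ j ∧ j ≤ n + 1}) (h : r ≤ genOrder n v) :
    (MvPolynomial.X v : ARing n) ∈ orderIdeal n r := by
  classical
  intro d hd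
  rw [MvPolynomial.coeff_X] at hd
  split_ifs at hd with hv
  · simpa [← hv, Finsupp.weight_single] using h
  · simp at hd

theorem aGen_of_mem {n j : ℕ} (h : 2 ≤ j ∧ j ≤ n + 1) : aGen n j = MvPolynomial.X ⟨j, h⟩ := by
  rw [aGen, if_neg (by omega), dif_pos h]

theorem aGen_eq_zero_s9 {n j : ℕ} (h0 : j ≠ 0) (h : ¬(2 ≤ j ∧ j ≤ n + 1)) : aGen n j = 0 := by
  rw [aGen, if_neg h0, dif_neg h]

theorem aGen_zero (n : ℕ) : aGen n 0 = 1 := if_pos rfl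

theorem aGen_mem_orderIdeal_one {n j : ℕ} (hj : j ≠ 0) : aGen n j ∈ orderIdeal n 1 := by
  by_cases h : 2 ≤ j ∧ j ≤ n + 1
  · rw [aGen_of_mem h]
    refine X_mem_orderIdeal _ ?_
    rw [genOrder]
    split_ifs <;> omega
  · rw [aGen_eq_zero_s9 hj h]
    exact zero_mem _

theorem aGen_mem_orderIdeal_two {n j : ℕ} (hj : j ≠ 0) (he : Even j) :
    aGen n j ∈ orderIdeal n 2 := by
  by_cases h : 2 ≤ j ∧ j ≤ n + 1
  · rw [aGen_of_mem h]
    refine X_mem_orderIdeal _ ?_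
    rw [genOrder, if_pos he]
  · rw [aGen_eq_zero_s9 hj h]
    exact zero_mem _

end OrderIdeal

section Homogeneity

theorem isWeightedHomogeneous_aGen (n j : ℕ) :
    MvPolynomial.IsWeightedHomogeneous (genWeight n) (aGen n j) j := by
  rcases eq_or_ne j 0 with rfl | hj
  · rw [aGen_zero]
    exact MvPolynomial.isWeightedHomogeneous_one _ _
  by_cases h : 2 ≤ j ∧ j ≤ n + 1
  · rw [aGen_of_mem h]
    exact MvPolynomial.isWeightedHomogeneous_X ℚ (genWeight n) ⟨j, h⟩
  · rw [aGen_eq_zero_s9 hj h]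
    exact MvPolynomial.isWeightedHomogeneous_zero _ _ _

/-- A polynomial in `x` over `A` that is homogeneous of weight `m`, where `x` has weight `1`. -/
def IsTotalHomogeneous (n : ℕ) (g : Polynomial (ARing n)) (m : ℕ) : Prop :=
  ∀ e d, (g.coeff e).coeff d ≠ 0 → Finsupp.weight (genWeight n) d + e = m

namespace IsTotalHomogeneous

variable {n m l : ℕ} {g g' : Polynomial (ARing n)}

theorem zero : IsTotalHomogeneous n 0 m := by
  intro e d h
  simp at h

theorem add (hg : IsTotalHomogeneous n g m) (hg' : IsTotalHomogeneous n g' m) :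
    IsTotalHomogeneous n (g + g') m := by
  intro e d h
  rw [coeff_add, MvPolynomial.coeff_add] at h
  by_cases h0 : (g.coeff e).coeff d = 0
  · exact hg' e d (by simpa [h0] using h)
  · exact hg e d h0

theorem sub (hg : IsTotalHomogeneous n g m) (hg' : IsTotalHomogeneous n g' m) :
    IsTotalHomogeneous n (g - g') m := by
  intro e d h
  rw [coeff_sub, MvPolynomial.coeff_sub] at h
  by_cases h0 : (g.coeff e).coeff d = 0
  · exact hg' e d (by simpa [h0] using h)
  · exact hg e d h0

theorem sum {ι : Type*} {s : Finset ι} {u : ι → Polynomial (ARing n)}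
    (h : ∀ i ∈ s, IsTotalHomogeneous n (u i) m) : IsTotalHomogeneous n (∑ i ∈ s, u i) m := by
  classical
  induction s using Finset.induction_on with
  | empty => simpa using zero
  | insert a s ha ih =>
    rw [Finset.sum_insert ha]
    exact (h a (Finset.mem_insert_self a s)).add
      (ih fun i hi => h i (Finset.mem_insert_of_mem hi))

theorem mul (hg : IsTotalHomogeneous n g m) (hg' : IsTotalHomogeneous n g' l) :
    IsTotalHomogeneous n (g * g') (m + l) := by
  intro e d h
  rw [coeff_mul, MvPolynomial.coeff_sum] at h
  obtain ⟨x, hx, hne⟩ := Finset.exists_ne_zero_of_sum_ne_zero h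
  rw [MvPolynomial.coeff_mul] at hne
  obtain ⟨y, hy, hne'⟩ := Finset.exists_ne_zero_of_sum_ne_zero hne
  have h1 := hg _ _ (left_ne_zero_of_mul hne')
  have h2 := hg' _ _ (right_ne_zero_of_mul hne')
  rw [← Finset.HasAntidiagonal.mem_antidiagonal.1 hx, ← Finset.HasAntidiagonal.mem_antidiagonal.1 hy, map_add]
  omega

theorem X_pow (e : ℕ) : IsTotalHomogeneous n (X ^ e) e := by
  classical
  intro e' d h
  rw [coeff_X_pow] at h
  split_ifs at h with he
  · rw [MvPolynomial.coeff_one] at h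
    split_ifs at h with hd
    · simp [← hd, he]
    · simp at h
  · simp at h

theorem C {p : ARing n} (hp : MvPolynomial.IsWeightedHomogeneous (genWeight n) p m) :
    IsTotalHomogeneous n (C p) m := by
  intro e d h
  rw [coeff_C] at h
  split_ifs at h with he
  · rw [he, add_zero]
    exact hp h
  · simp at h

theorem intCast (z : ℤ) : IsTotalHomogeneous n (z : Polynomial (ARing n)) 0 := by
  have h := C (MvPolynomial.isWeightedHomogeneous_C (genWeight n) (z : ℚ))
  simpa using h

theorem intCast_mul (z : ℤ) (hg : IsTotalHomogeneous n g m) :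
    IsTotalHomogeneous n ((z : Polynomial (ARing n)) * g) m := by
  simpa using (intCast z).mul hg

theorem pow (hg : IsTotalHomogeneous n g m) (l : ℕ) : IsTotalHomogeneous n (g ^ l) (l * m) := by
  induction l with
  | zero => simpa using intCast (n := n) 1
  | succ l ih => simpa [pow_succ, add_mul] using ih.mul hg

end IsTotalHomogeneous

theorem isTotalHomogeneous_cfw (n i : ℕ) : IsTotalHomogeneous n (cfw n i) i := by
  refine IsTotalHomogeneous.sum fun j hj => ?_
  have h := (IsTotalHomogeneous.intCast_mul ((n + 1 - j).choose (i - j) : ℤ)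
    (IsTotalHomogeneous.C (isWeightedHomogeneous_aGen n j))).mul
    (IsTotalHomogeneous.X_pow (n := n) (i - j))
  have : j + (i - j) = i := by
    have := Finset.mem_range.1 hj
    omega
  rw [this] at h
  simpa using h

theorem isTotalHomogeneous_psfw (n s : ℕ) : IsTotalHomogeneous n (psfw n s) (2 * s) := by
  refine IsTotalHomogeneous.sum fun j hj => ?_
  have h := IsTotalHomogeneous.intCast_mul ((-1) ^ (j + s))
    ((isTotalHomogeneous_cfw n j).mul (isTotalHomogeneous_cfw n (2 * s - j)))
  have : j + (2 * s - j) = 2 * s := by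
    have := Finset.mem_range.1 hj
    omega
  rw [this] at h
  simpa [mul_assoc] using h

theorem isTotalHomogeneous_betaCl (n s : ℕ) : IsTotalHomogeneous n (betaCl n s) (2 * s) := by
  have h1 := IsTotalHomogeneous.intCast_mul ((n + 1 : ℤ) ^ s) (isTotalHomogeneous_psfw n s)
  have h2 := IsTotalHomogeneous.intCast_mul ((n + 1).choose s : ℤ)
    ((isTotalHomogeneous_psfw n 1).pow s)
  rw [show s * (2 * 1) = 2 * s by ring] at h2
  simpa [betaCl] using h1.sub h2

end Homogeneity

section Pushforward

theorem fPoly_tail_degree (n : ℕ) :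
    (∑ j ∈ Finset.Icc 2 (n + 1), C (aGen n j) * X ^ (n + 1 - j)).degree < ((n + 1 : ℕ) : WithBot ℕ) := by
  refine (degree_sum_le _ _).trans_lt ((Finset.sup_lt_iff (WithBot.bot_lt_coe _)).2 fun j hj => ?_)
  refine (degree_C_mul_X_pow_le _ _).trans_lt ?_
  have := Finset.mem_Icc.1 hj
  exact_mod_cast (by omega : n + 1 - j < n + 1)

theorem fPoly_monic (n : ℕ) : (fPoly n).Monic := monic_X_pow_add (fPoly_tail_degree n)

theorem degree_fPoly (n : ℕ) : (fPoly n).degree = ((n + 1 : ℕ) : WithBot ℕ) := by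
  rw [fPoly, degree_add_eq_left_of_degree_lt, degree_X_pow]
  rw [degree_X_pow]
  exact fPoly_tail_degree n

/-- `piShriek` as an `A`-linear map. -/
def piShriekLin (n : ℕ) : Polynomial (ARing n) →ₗ[ARing n] ARing n :=
  lcoeff (ARing n) n ∘ₗ modByMonicHom (fPoly n)

theorem piShriekLin_apply (n : ℕ) (g : Polynomial (ARing n)) :
    piShriekLin n g = piShriek n g := rfl

theorem piShriekLin_C_mul (n : ℕ) (a : ARing n) (g : Polynomial (ARing n)) :
    piShriekLin n (C a * g) = a * piShriekLin n g := by
  rw [← smul_eq_C_mul, map_smul, smul_eq_mul]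

theorem piShriekLin_intCast_mul (n : ℕ) (z : ℤ) (g : Polynomial (ARing n)) :
    piShriekLin n (z * g) = z * piShriekLin n g := by
  rw [← piShriekLin_C_mul, map_intCast]

theorem piShriekLin_X_pow_of_le {n e : ℕ} (h : e ≤ n) :
    piShriekLin n (X ^ e) = if n = e then 1 else 0 := by
  have : (X ^ e : Polynomial (ARing n)) %ₘ fPoly n = X ^ e := by
    rw [modByMonic_eq_self_iff (fPoly_monic n), degree_X_pow, degree_fPoly]
    exact_mod_cast (by omega : e < n + 1)
  rw [piShriekLin_apply, piShriek, this, coeff_X_pow]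

/-- The recursion satisfied by the pushforwards of the powers of `x`. -/
theorem piShriekLin_X_pow_rec (n m : ℕ) (hm : 1 ≤ m) :
    piShriekLin n (X ^ (n + m)) =
      -∑ j ∈ Finset.Icc 2 m, aGen n j * piShriekLin n (X ^ (n + m - j)) := by
  obtain ⟨m, rfl⟩ : ∃ m', m = m' + 1 := ⟨m - 1, by omega⟩
  have h0 : piShriekLin n (fPoly n * X ^ m) = 0 := by
    rw [piShriekLin_apply, piShriek, self_mul_modByMonic (fPoly_monic n), coeff_zero]
  have hsplit : fPoly n * X ^ m = X ^ (n + (m + 1)) +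
      ∑ j ∈ Finset.Icc 2 (n + 1), C (aGen n j) * X ^ (n + (m + 1) - j) := by
    rw [fPoly, add_mul, ← pow_add, Finset.sum_mul, show n + 1 + m = n + (m + 1) by omega]
    refine congrArg₂ _ rfl (Finset.sum_congr rfl fun j hj => ?_)
    have := Finset.mem_Icc.1 hj
    rw [mul_assoc, ← pow_add, show n + 1 - j + m = n + (m + 1) - j by omega]
  rw [hsplit, map_add, map_sum] at h0
  rw [eq_neg_of_add_eq_zero_left h0]
  congr 1
  simp only [piShriekLin_C_mul]
  trans ∑ j ∈ Finset.Icc 2 (n + 1 + m), aGen n j * piShriekLin n (X ^ (n + (m + 1) - j))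
  · refine Finset.sum_subset (Finset.Icc_subset_Icc_right (by omega)) fun j hj hj' => ?_
    rw [Finset.mem_Icc] at hj hj'
    rw [aGen_eq_zero_s9 (by omega) (by omega), zero_mul]
  · symm
    refine Finset.sum_subset (Finset.Icc_subset_Icc_right (by omega)) fun j hj hj' => ?_
    rw [Finset.mem_Icc] at hj hj'
    rw [piShriekLin_X_pow_of_le (by omega), if_neg (by omega), mul_zero]

theorem piShriekLin_eq_sum (n : ℕ) (g : Polynomial (ARing n)) :
    piShriekLin n g = ∑ e ∈ g.support, g.coeff e * piShriekLin n (X ^ e) := by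
  conv_lhs => rw [g.as_sum_support_C_mul_X_pow, map_sum]
  simp only [piShriekLin_C_mul]

theorem isWeightedHomogeneous_piShriekLin_X_pow (n m : ℕ) :
    MvPolynomial.IsWeightedHomogeneous (genWeight n) (piShriekLin n (X ^ (n + m))) m := by
  induction m using Nat.strong_induction_on with
  | _ m ih =>
    rcases Nat.eq_zero_or_pos m with rfl | hm
    · rw [add_zero, piShriekLin_X_pow_of_le le_rfl, if_pos rfl]
      exact MvPolynomial.isWeightedHomogeneous_one _ _
    · rw [piShriekLin_X_pow_rec n m hm]
      refine (MvPolynomial.IsWeightedHomogeneous.sum _ _ _ fun j hj => ?_).neg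
      have hj := Finset.mem_Icc.1 hj
      have h := (isWeightedHomogeneous_aGen n j).mul (ih (m - j) (by omega))
      rwa [← Nat.add_sub_assoc hj.2, Nat.add_sub_cancel' hj.2] at h

theorem IsTotalHomogeneous.piShriekLin {n m : ℕ} {g : Polynomial (ARing n)}
    (hg : IsTotalHomogeneous n g (n + m)) :
    MvPolynomial.IsWeightedHomogeneous (genWeight n) (piShriekLin n g) m := by
  rw [piShriekLin_eq_sum]
  refine MvPolynomial.IsWeightedHomogeneous.sum _ _ _ fun e _ => ?_
  rcases lt_or_ge e n with he | he
  · rw [piShriekLin_X_pow_of_le he.le, if_neg he.ne', mul_zero]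
    exact MvPolynomial.isWeightedHomogeneous_zero _ _ _
  · obtain ⟨e, rfl⟩ := Nat.exists_eq_add_of_le he
    intro d hd
    rw [MvPolynomial.coeff_mul] at hd
    obtain ⟨x, hx, hne⟩ := Finset.exists_ne_zero_of_sum_ne_zero hd
    have h1 := hg _ _ (left_ne_zero_of_mul hne)
    have h2 := isWeightedHomogeneous_piShriekLin_X_pow n e (right_ne_zero_of_mul hne)
    rw [← Finset.HasAntidiagonal.mem_antidiagonal.1 hx, map_add]
    omega

theorem piShriekLin_mem {n : ℕ} {I : Ideal (ARing n)} {g : Polynomial (ARing n)}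
    (hg : g ∈ I.map C) : piShriekLin n g ∈ I := by
  rw [piShriekLin_eq_sum]
  exact sum_mem fun e _ => I.mul_mem_right _ (Ideal.mem_map_C_iff.1 hg e)

theorem piShriekLin_X_pow_mem_orderIdeal {n m : ℕ} (hm : 1 ≤ m) :
    piShriekLin n (X ^ (n + m)) ∈ orderIdeal n 1 := by
  rw [piShriekLin_X_pow_rec n m hm]
  refine neg_mem (sum_mem fun j hj => Ideal.mul_mem_right _ _ (aGen_mem_orderIdeal_one ?_))
  have := Finset.mem_Icc.1 hj
  omega

theorem piShriekLin_X_pow_succ (n m : ℕ) :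
    piShriekLin n (X ^ (n + (m + 1))) = -aGen n (m + 1) -
      ∑ j ∈ Finset.Icc 2 m, aGen n j * piShriekLin n (X ^ (n + (m + 1 - j))) := by
  rw [piShriekLin_X_pow_rec n (m + 1) (by omega)]
  rcases Nat.eq_zero_or_pos m with rfl | hm
  · simp [aGen]
  · rw [Finset.sum_Icc_succ_top (by omega), Nat.add_sub_cancel,
      piShriekLin_X_pow_of_le le_rfl, if_pos rfl, mul_one, neg_add_rev, ← sub_eq_add_neg]
    congr 1
    refine Finset.sum_congr rfl fun j hj => ?_
    have := Finset.mem_Icc.1 hj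
    rw [Nat.add_sub_assoc (by omega)]

theorem piShriekLin_X_pow_add_aGen_mem {n m : ℕ} (hm : 1 ≤ m) :
    piShriekLin n (X ^ (n + m)) + aGen n m ∈ orderIdeal n 2 := by
  obtain ⟨m, rfl⟩ : ∃ m', m = m' + 1 := ⟨m - 1, by omega⟩
  rw [piShriekLin_X_pow_succ, sub_add_eq_add_sub, neg_add_cancel, zero_sub]
  refine neg_mem (sum_mem fun j hj => ?_)
  have := Finset.mem_Icc.1 hj
  exact mul_mem_orderIdeal (aGen_mem_orderIdeal_one (by omega))
    (piShriekLin_X_pow_mem_orderIdeal (by omega))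

theorem aGen_mul_piShriekLin_add_mem {n j m : ℕ} (hj : j ≠ 0) (hm : 1 ≤ m) :
    aGen n j * piShriekLin n (X ^ (n + m)) + aGen n j * aGen n m ∈ orderIdeal n 3 := by
  rw [← mul_add]
  exact mul_mem_orderIdeal (aGen_mem_orderIdeal_one hj) (piShriekLin_X_pow_add_aGen_mem hm)

theorem piShriekLin_X_pow_add_aGen_sub_sum_mem (n m : ℕ) :
    piShriekLin n (X ^ (n + (m + 1))) + aGen n (m + 1) -
      ∑ j ∈ Finset.Icc 2 m, aGen n j * aGen n (m + 1 - j) ∈ orderIdeal n 3 := by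
  rw [piShriekLin_X_pow_succ, sub_add_eq_add_sub, neg_add_cancel, zero_sub, ← neg_add',
    ← Finset.sum_add_distrib]
  refine neg_mem (sum_mem fun j hj => ?_)
  have := Finset.mem_Icc.1 hj
  exact aGen_mul_piShriekLin_add_mem (by omega) (by omega)

end Pushforward

section Expansion

/-- The part of `cfw n i` without the leading term `x ^ i`. -/
def cfwTail (n i : ℕ) : Polynomial (ARing n) :=
  ∑ j ∈ Finset.Icc 1 i,
    C ((((n + 1 - j).choose (i - j) : ℕ) : ARing n) * aGen n j) * X ^ (i - j)

theorem cfw_eq (n i : ℕ) :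
    cfw n i = ((n + 1).choose i : Polynomial (ARing n)) * X ^ i + cfwTail n i := by
  have h : Finset.Ico (0 + 1) (i + 1) = Finset.Icc 1 i := by
    ext
    simp
  rw [cfw, Finset.range_eq_Ico, Finset.sum_eq_sum_Ico_succ_bot (by omega), h, cfwTail]
  simp [aGen_zero]

theorem cfwTail_mem (n i : ℕ) : cfwTail n i ∈ (orderIdeal n 1).map C := by
  refine sum_mem fun j hj => Ideal.mul_mem_right _ _ (Ideal.mem_map_of_mem C ?_)
  have := Finset.mem_Icc.1 hj
  exact Ideal.mul_mem_left _ _ (aGen_mem_orderIdeal_one (by omega))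

theorem mul_mem_map_orderIdeal {n a b : ℕ} {g g' : Polynomial (ARing n)}
    (hg : g ∈ (orderIdeal n a).map C) (hg' : g' ∈ (orderIdeal n b).map C) :
    g * g' ∈ (orderIdeal n (a + b)).map C := by
  refine Ideal.map_mono (orderIdeal_mul_le n a b) ?_
  rw [Ideal.map_mul]
  exact Ideal.mul_mem_mul hg hg'

theorem sum_neg_one_pow_mul_choose_mul_choose_s9 (N s : ℕ) :
    ∑ j ∈ Finset.range (2 * s + 1), (-1 : ℤ) ^ (j + s) * N.choose j * N.choose (2 * s - j) =
      N.choose s := by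
  have hneg (m : ℕ) : ((1 - X : ℤ[X]) ^ N).coeff m = (-1) ^ m * N.choose m := by
    have h : (1 - X : ℤ[X]) ^ N = ((1 + X) ^ N).comp (C (-1) * X) := by
      simp [sub_eq_add_neg]
    rw [h, comp_C_mul_X_coeff, coeff_one_add_X_pow, mul_comm]
  have h : (expand ℤ 2 ((1 - X) ^ N)).coeff (s * 2) =
      ((1 - X : ℤ[X]) ^ N * (1 + X) ^ N).coeff (s * 2) := by
    rw [← mul_pow, map_pow]
    congr 2
    simp
    ring
  rw [coeff_expand_mul (by norm_num), hneg, coeff_mul, Finset.Nat.sum_antidiagonal_eq_sum_range_succ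
    fun i j => ((1 - X : ℤ[X]) ^ N).coeff i * ((1 + X : ℤ[X]) ^ N).coeff j] at h
  simp only [hneg, coeff_one_add_X_pow] at h
  rw [mul_comm 2 s]
  simp only [pow_add, mul_assoc, mul_left_comm _ ((-1 : ℤ) ^ s), ← Finset.mul_sum] at h ⊢
  rw [← h, ← mul_assoc, ← mul_pow]
  simp

/-- The coefficient of `a_j x ^ (2 * s - j)` in `psfw n s`. -/
def psfwCoeff (n s j : ℕ) : ℤ :=
  2 * ∑ i ∈ Finset.Icc j (2 * s),
    (-1 : ℤ) ^ (i + s) * (n + 1).choose (2 * s - i) * (n + 1 - j).choose (i - j)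

theorem psfwCoeff_ne_zero {n s : ℕ} (hs : 1 ≤ s) (hn : 2 * s - 1 ≤ n + 1) :
    psfwCoeff n s (2 * s - 1) ≠ 0 := by
  obtain ⟨s, rfl⟩ : ∃ s', s = s' + 1 := ⟨s - 1, by omega⟩
  obtain ⟨m, hm⟩ := Nat.exists_eq_add_of_le hn
  rw [psfwCoeff, show 2 * (s + 1) = (2 * s + 1) + 1 by ring, Nat.add_sub_cancel,
    Finset.sum_Icc_succ_top (by omega), Finset.Icc_self, Finset.sum_singleton, hm,
    show 2 * (s + 1) - 1 = 2 * s + 1 by omega]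
  simp only [Nat.add_sub_cancel_left, Nat.sub_self, Nat.choose_zero_right, Nat.choose_one_right]
  have h : (-1 : ℤ) ^ (2 * s + 1 + 1 + (s + 1)) = - (-1) ^ (2 * s + 1 + (s + 1)) := by ring
  rw [h]
  push_cast
  intro h0
  have h1 : (-1 : ℤ) ^ (2 * s + 1 + (s + 1)) * (2 * (2 * s + 1)) = 0 := by
    generalize (-1 : ℤ) ^ (2 * s + 1 + (s + 1)) = u at h0 ⊢
    linear_combination h0
  rcases mul_eq_zero.1 h1 with h2 | h2
  · exact pow_ne_zero _ (by norm_num) h2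
  · omega

theorem sum_cfwTail_eq (n s : ℕ) :
    2 * ∑ i ∈ Finset.range (2 * s + 1), (-1) ^ (i + s) *
      (((n + 1).choose (2 * s - i) : Polynomial (ARing n)) * X ^ (2 * s - i)) * cfwTail n i =
    ∑ j ∈ Finset.Icc 1 (2 * s),
      (psfwCoeff n s j : Polynomial (ARing n)) * (C (aGen n j) * X ^ (2 * s - j)) := by
  simp only [cfwTail, psfwCoeff, Finset.mul_sum, Int.cast_sum, Int.cast_mul, Finset.sum_mul]
  rw [Finset.sum_comm' (t' := Finset.Icc 1 (2 * s)) (s' := fun j => Finset.Icc j (2 * s))]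
  · refine Finset.sum_congr rfl fun j hj => Finset.sum_congr rfl fun i hi => ?_
    have := Finset.mem_Icc.1 hi
    rw [show 2 * s - j = (2 * s - i) + (i - j) by omega, pow_add]
    simp
    ring
  · intro i j
    simp only [Finset.mem_range, Finset.mem_Icc]
    omega

theorem psfw_sub_mem (n s : ℕ) :
    psfw n s - (((n + 1).choose s : Polynomial (ARing n)) * X ^ (2 * s) +
      ∑ j ∈ Finset.Icc 1 (2 * s),
        (psfwCoeff n s j : Polynomial (ARing n)) * (C (aGen n j) * X ^ (2 * s - j))) ∈
      (orderIdeal n 2).map C := by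
  have hchoose := congrArg (Int.cast : ℤ → Polynomial (ARing n))
    (sum_neg_one_pow_mul_choose_mul_choose_s9 (n + 1) s)
  push_cast at hchoose
  have hflip := Finset.sum_flip (n := 2 * s) fun i => (-1) ^ (i + s) *
    (((n + 1).choose (2 * s - i) : Polynomial (ARing n)) * X ^ (2 * s - i)) * cfwTail n i
  rw [← sum_cfwTail_eq, two_mul (Finset.sum _ _)]
  nth_rw 1 [← hflip]
  rw [← hchoose, psfw, Finset.sum_mul, ← Finset.sum_add_distrib, ← Finset.sum_add_distrib,
    ← Finset.sum_sub_distrib]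
  refine sum_mem fun i hi => ?_
  have hi := Finset.mem_range.1 hi
  have hsign : (-1 : Polynomial (ARing n)) ^ (2 * s - i + s) = (-1) ^ (i + s) := by
    refine neg_one_pow_congr (R := Polynomial (ARing n)) ?_
    simp only [Nat.even_iff]
    omega
  have hX : (X : Polynomial (ARing n)) ^ (2 * s) = X ^ i * X ^ (2 * s - i) := by
    rw [← pow_add]
    congr 1
    omega
  have key := Ideal.mul_mem_left _ ((-1 : Polynomial (ARing n)) ^ (i + s))
    (mul_mem_map_orderIdeal (cfwTail_mem n i) (cfwTail_mem n (2 * s - i)))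
  convert key using 1
  rw [cfw_eq, cfw_eq, hsign, hX, show 2 * s - (2 * s - i) = i by omega]
  ring

theorem psfw_one (n : ℕ) :
    psfw n 1 = ((n + 1 : ℕ) : Polynomial (ARing n)) * X ^ 2 + -(2 * C (aGen n 2)) := by
  have h : (((n + 1).choose 2 : ℕ) : Polynomial (ARing n)) * 2 = (n + 1) * n := by
    have h := Nat.choose_two_right (n + 1)
    have h2 : (n + 1).choose 2 * 2 = (n + 1) * n := by
      rw [h]
      exact Nat.div_mul_cancel (Nat.even_mul_pred_self _).two_dvd
    exact_mod_cast congrArg (Nat.cast : ℕ → Polynomial (ARing n)) h2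
  have h1 : aGen n 1 = 0 := by simp [aGen]
  simp [psfw, cfw, Finset.sum_range_succ, aGen_zero, h1]
  linear_combination (-X ^ 2) * h

theorem psfw_one_pow_sub_mem_two (n l : ℕ) :
    psfw n 1 ^ l - ((n + 1 : ℕ) : Polynomial (ARing n)) ^ l * X ^ (2 * l) ∈
      (orderIdeal n 2).map C := by
  have h2 : C (aGen n 2) ∈ (orderIdeal n 2).map C :=
    Ideal.mem_map_of_mem C (aGen_mem_orderIdeal_two (by norm_num) even_two)
  rw [pow_mul, ← mul_pow]
  refine Ideal.mem_of_dvd _ (sub_dvd_pow_sub_pow _ _ l) ?_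
  rw [psfw_one, add_sub_cancel_left]
  exact neg_mem (Ideal.mul_mem_left _ _ h2)

theorem psfw_one_pow_sub_mem_three (n l : ℕ) :
    psfw n 1 ^ l - (((n + 1 : ℕ) : Polynomial (ARing n)) ^ l * X ^ (2 * l) -
      ((2 * l * (n + 1) ^ (l - 1) : ℕ) : Polynomial (ARing n)) *
        (C (aGen n 2) * X ^ (2 * (l - 1)))) ∈ (orderIdeal n 3).map C := by
  have h2 : C (aGen n 2) ∈ (orderIdeal n 2).map C :=
    Ideal.mem_map_of_mem C (aGen_mem_orderIdeal_two (by norm_num) even_two)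
  have h4 : C (aGen n 2) * C (aGen n 2) ∈ (orderIdeal n 3).map C :=
    Ideal.map_mono (orderIdeal_anti (by norm_num)) (mul_mem_map_orderIdeal h2 h2)
  obtain ⟨z, hz⟩ := powAddExpansion (((n + 1 : ℕ) : Polynomial (ARing n)) * X ^ 2)
    (-(2 * C (aGen n 2))) l
  rw [psfw_one, hz]
  convert Ideal.mul_mem_left _ (4 * z) h4 using 1
  simp only [mul_pow, pow_mul]
  push_cast
  ring

/-- The linear part of `betaCl n s`. -/
def betaLin (n s : ℕ) : Polynomial (ARing n) :=
  ((n + 1 : ℕ) : Polynomial (ARing n)) ^ s * ∑ j ∈ Finset.Icc 1 (2 * s),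
    (psfwCoeff n s j : Polynomial (ARing n)) * (C (aGen n j) * X ^ (2 * s - j))

theorem betaCl_sub_mem (n s : ℕ) :
    betaCl n s - betaLin n s ∈ (orderIdeal n 2).map C := by
  have h := sub_mem
    (Ideal.mul_mem_left _ (((n + 1 : ℕ) : Polynomial (ARing n)) ^ s) (psfw_sub_mem n s))
    (Ideal.mul_mem_left _ ((n + 1).choose s : Polynomial (ARing n)) (psfw_one_pow_sub_mem_two n s))
  convert h using 1
  rw [betaCl, betaLin, map_natCast, map_natCast, Nat.cast_pow]
  ring

theorem betaCl_mem (n s : ℕ) : betaCl n s ∈ (orderIdeal n 1).map C := by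
  have h : betaLin n s ∈ (orderIdeal n 1).map C := by
    refine Ideal.mul_mem_left _ _ (sum_mem fun j hj => Ideal.mul_mem_left _ _
      (Ideal.mul_mem_right _ _ (Ideal.mem_map_of_mem C (aGen_mem_orderIdeal_one ?_))))
    have := Finset.mem_Icc.1 hj
    omega
  simpa using add_mem (Ideal.map_mono (orderIdeal_anti one_le_two) (betaCl_sub_mem n s)) h

theorem piShriekLin_X_pow_mul_mem {n m : ℕ} {g : Polynomial (ARing n)} (hm : n < m)
    (hg : g ∈ (orderIdeal n 2).map C) : piShriekLin n (X ^ m * g) ∈ orderIdeal n 3 := by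
  rw [g.as_sum_support_C_mul_X_pow, Finset.mul_sum, map_sum]
  refine sum_mem fun e _ => ?_
  rw [mul_left_comm, piShriekLin_C_mul, ← pow_add, show m + e = n + (m + e - n) by omega]
  exact mul_mem_orderIdeal (Ideal.mem_map_C_iff.1 hg e)
    (piShriekLin_X_pow_mem_orderIdeal (by omega))

/-- The quadratic part of the pushforward of `psfw n 1 ^ l * betaCl n s`. -/
theorem piShriekLin_psfw_one_pow_mul_betaCl_add_mem {n l s d : ℕ} (hl : n < 2 * l) (hsd : s < d)
    (hd : 2 * l + 2 * s = n + 2 * d) :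
    piShriekLin n (psfw n 1 ^ l * betaCl n s) +
      (((n + 1 : ℕ) : ARing n)) ^ (l + s) * ∑ j ∈ Finset.Icc 1 (2 * s),
        (psfwCoeff n s j : ARing n) * (aGen n j * aGen n (2 * d - j)) ∈ orderIdeal n 3 := by
  have h1 := piShriekLin_mem (mul_mem_map_orderIdeal (psfw_one_pow_sub_mem_two n l) (betaCl_mem n s))
  have h2 := Ideal.mul_mem_left _ (((n + 1 : ℕ) : ARing n) ^ l)
    (piShriekLin_X_pow_mul_mem hl (betaCl_sub_mem n s))
  have h3 : piShriekLin n (X ^ (2 * l) * betaLin n s) +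
      ((n + 1 : ℕ) : ARing n) ^ s * ∑ j ∈ Finset.Icc 1 (2 * s),
        (psfwCoeff n s j : ARing n) * (aGen n j * aGen n (2 * d - j)) ∈ orderIdeal n 3 := by
    have h : piShriekLin n (X ^ (2 * l) * betaLin n s) =
        ((n + 1 : ℕ) : ARing n) ^ s * ∑ j ∈ Finset.Icc 1 (2 * s), (psfwCoeff n s j : ARing n) *
          (aGen n j * piShriekLin n (X ^ (n + (2 * d - j)))) := by
      rw [betaLin, mul_left_comm, ← Nat.cast_pow, ← map_natCast C, piShriekLin_C_mul,
        Finset.mul_sum, map_sum, Nat.cast_pow]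
      congr 1
      refine Finset.sum_congr rfl fun j hj => ?_
      have := Finset.mem_Icc.1 hj
      rw [mul_left_comm, piShriekLin_intCast_mul, mul_left_comm, piShriekLin_C_mul, ← pow_add,
        show 2 * l + (2 * s - j) = n + (2 * d - j) by omega]
    rw [h, ← mul_add, ← Finset.sum_add_distrib]
    refine Ideal.mul_mem_left _ _ (sum_mem fun j hj => ?_)
    have := Finset.mem_Icc.1 hj
    rw [← mul_add]
    exact Ideal.mul_mem_left _ _ (aGen_mul_piShriekLin_add_mem (by omega) (by omega))
  have h4 := add_mem (add_mem h1 h2) (Ideal.mul_mem_left _ (((n + 1 : ℕ) : ARing n) ^ l) h3)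
  have hsplit : psfw n 1 ^ l * betaCl n s =
      (psfw n 1 ^ l - ((n + 1 : ℕ) : Polynomial (ARing n)) ^ l * X ^ (2 * l)) * betaCl n s +
        C (((n + 1 : ℕ) : ARing n) ^ l) * (X ^ (2 * l) * (betaCl n s - betaLin n s)) +
        C (((n + 1 : ℕ) : ARing n) ^ l) * (X ^ (2 * l) * betaLin n s) := by
    rw [map_pow, map_natCast]
    ring
  rw [hsplit, map_add, map_add, piShriekLin_C_mul, piShriekLin_C_mul]
  convert h4 using 1
  ring

theorem piShriekLin_psfw_one_pow_sub_mem {n l d : ℕ} (hd : 2 * l = n + 2 * d) (h1 : 1 ≤ d) :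
    piShriekLin n (psfw n 1 ^ l) - (((n + 1 : ℕ) : ARing n) ^ l * piShriekLin n (X ^ (n + 2 * d)) -
      ((2 * l * (n + 1) ^ (l - 1) : ℕ) : ARing n) *
        (aGen n 2 * piShriekLin n (X ^ (n + 2 * (d - 1))))) ∈ orderIdeal n 3 := by
  have h := piShriekLin_mem (psfw_one_pow_sub_mem_three n l)
  rw [map_sub, map_sub] at h
  convert h using 3
  · rw [← piShriekLin_C_mul, hd, map_pow, map_natCast]
  · rw [← piShriekLin_C_mul, ← piShriekLin_C_mul, map_natCast,
      show 2 * (l - 1) = n + 2 * (d - 1) by omega]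

end Expansion

section Splitting

theorem exists_eq_single_add {ι : Type*} {d : ι →₀ ℕ} (h : d ≠ 0) :
    ∃ i d', d = Finsupp.single i 1 + d' := by
  obtain ⟨i, hi⟩ := Finsupp.ne_iff.1 h
  exact ⟨i, d - Finsupp.single i 1,
    (add_tsub_cancel_of_le (Finsupp.single_le_iff.2 (Nat.one_le_iff_ne_zero.2 hi))).symm⟩

theorem weight_single_one {ι : Type*} (w : ι → ℕ) (i : ι) :
    Finsupp.weight w (Finsupp.single i 1) = w i := by
  simp [Finsupp.weight_single]

theorem weight_genWeight_pos {n : ℕ} {d : {j : ℕ // 2 ≤ j ∧ j ≤ n + 1} →₀ ℕ} (h : d ≠ 0) :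
    0 < Finsupp.weight (genWeight n) d := by
  obtain ⟨i, d', rfl⟩ := exists_eq_single_add h
  rw [map_add, weight_single_one, genWeight]
  have := i.2
  omega

/-- A monomial of even weight is constant, an even generator, a product of two odd generators, or
a product of two nonconstant monomials of even weight. -/
theorem even_weight_cases {n : ℕ} {d : {j : ℕ // 2 ≤ j ∧ j ≤ n + 1} →₀ ℕ}
    (h : Even (Finsupp.weight (genWeight n) d)) :
    d = 0 ∨ (∃ i : {j : ℕ // 2 ≤ j ∧ j ≤ n + 1}, Even (i : ℕ) ∧ d = Finsupp.single i 1) ∨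
    (∃ i j : {j : ℕ // 2 ≤ j ∧ j ≤ n + 1},
      Odd (i : ℕ) ∧ Odd (j : ℕ) ∧ d = Finsupp.single i 1 + Finsupp.single j 1) ∨
    ∃ d₁ d₂, d = d₁ + d₂ ∧ d₁ ≠ 0 ∧ d₂ ≠ 0 ∧
      Even (Finsupp.weight (genWeight n) d₁) ∧ Even (Finsupp.weight (genWeight n) d₂) := by
  have single_ne (i : {j : ℕ // 2 ≤ j ∧ j ≤ n + 1}) : Finsupp.single i 1 ≠ 0 :=
    Finsupp.single_ne_zero.2 one_ne_zero
  rcases eq_or_ne d 0 with h0 | h0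
  · exact Or.inl h0
  obtain ⟨i, d, rfl⟩ := exists_eq_single_add h0
  rw [map_add, weight_single_one, genWeight] at h
  rcases Nat.even_or_odd (i : ℕ) with hi | hi
  · rcases eq_or_ne d 0 with rfl | hd
    · exact Or.inr (Or.inl ⟨i, hi, add_zero _⟩)
    · refine Or.inr (Or.inr (Or.inr ⟨_, d, rfl, single_ne i, hd, ?_, (Nat.even_add.1 h).1 hi⟩))
      rwa [weight_single_one, genWeight]
  · have hd : Odd (Finsupp.weight (genWeight n) d) := by
      rw [← Nat.not_even_iff_odd] at hi ⊢
      rwa [← Nat.even_add.1 h]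
    obtain ⟨j, d, rfl⟩ := exists_eq_single_add (d := d) (by rintro rfl; simp at hd)
    rw [map_add, weight_single_one, genWeight] at hd
    rcases Nat.even_or_odd (j : ℕ) with hj | hj
    · refine Or.inr (Or.inr (Or.inr ⟨Finsupp.single j 1, Finsupp.single i 1 + d,
        add_left_comm _ _ _, single_ne j, ?_, ?_, ?_⟩))
      · intro h1
        exact single_ne i (add_eq_zero.1 h1).1
      · rwa [weight_single_one, genWeight]
      · rw [map_add, weight_single_one, genWeight]
        exact hi.add_odd ((Nat.odd_add'.1 hd).2 hj)
    · rcases eq_or_ne d 0 with rfl | hd0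
      · exact Or.inr (Or.inr (Or.inl ⟨i, j, hi, hj, by rw [add_zero]⟩))
      · refine Or.inr (Or.inr (Or.inr ⟨Finsupp.single i 1 + Finsupp.single j 1, d,
          (add_assoc _ _ _).symm, ?_, hd0, ?_, (Nat.odd_add.1 hd).1 hj⟩))
        · intro h1
          exact single_ne i (add_eq_zero.1 h1).1
        · rw [map_add, weight_single_one, weight_single_one, genWeight, genWeight]
          exact hi.add_odd hj

end Splitting

section Generation

/-- All monomials of even weight less than `2 * m` lie in `S`. -/
def ContainsEvenBelow (n m : ℕ) (S : Subalgebra ℚ (ARing n)) : Prop :=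
  ∀ d, Even (Finsupp.weight (genWeight n) d) → Finsupp.weight (genWeight n) d < 2 * m →
    MvPolynomial.monomial d 1 ∈ S

theorem mem_of_intCast_mul_mem {R : Type*} [CommRing R] [Algebra ℚ R] {S : Subalgebra ℚ R}
    {z : ℤ} (hz : z ≠ 0) {p : R} (h : (z : R) * p ∈ S) : p ∈ S := by
  have := S.smul_mem h ((z : ℚ)⁻¹)
  rwa [← zsmul_eq_mul, ← Int.cast_smul_eq_zsmul ℚ, smul_smul,
    inv_mul_cancel₀ (Int.cast_ne_zero.2 hz), one_smul] at this

theorem mem_of_natCast_mul_mem {R : Type*} [CommRing R] [Algebra ℚ R] {S : Subalgebra ℚ R}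
    {z : ℕ} (hz : z ≠ 0) {p : R} (h : (z : R) * p ∈ S) : p ∈ S :=
  mem_of_intCast_mul_mem (z := z) (by exact_mod_cast hz) (by simpa using h)

theorem isWeightedHomogeneous_intCast_mul {n m : ℕ} {p : ARing n} (z : ℤ)
    (hp : MvPolynomial.IsWeightedHomogeneous (genWeight n) p m) :
    MvPolynomial.IsWeightedHomogeneous (genWeight n) ((z : ARing n) * p) m := by
  simpa using (MvPolynomial.isWeightedHomogeneous_C (genWeight n) (z : ℚ)).mul hp

theorem isWeightedHomogeneous_natCast_mul {n m : ℕ} {p : ARing n} (z : ℕ)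
    (hp : MvPolynomial.IsWeightedHomogeneous (genWeight n) p m) :
    MvPolynomial.IsWeightedHomogeneous (genWeight n) ((z : ARing n) * p) m := by
  simpa using isWeightedHomogeneous_intCast_mul (z : ℤ) hp

theorem isWeightedHomogeneous_aGen_mul_aGen {n j m : ℕ} (h : j ≤ m) :
    MvPolynomial.IsWeightedHomogeneous (genWeight n) (aGen n j * aGen n (m - j)) m := by
  simpa [Nat.add_sub_cancel' h] using
    (isWeightedHomogeneous_aGen n j).mul (isWeightedHomogeneous_aGen n (m - j))

namespace ContainsEvenBelow

variable {n m : ℕ} {S : Subalgebra ℚ (ARing n)}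

theorem monomial_add_mem (hS : ContainsEvenBelow n m S)
    {d₁ d₂ : {j : ℕ // 2 ≤ j ∧ j ≤ n + 1} →₀ ℕ} (h₁ : d₁ ≠ 0) (h₂ : d₂ ≠ 0)
    (e₁ : Even (Finsupp.weight (genWeight n) d₁)) (e₂ : Even (Finsupp.weight (genWeight n) d₂))
    (h : Finsupp.weight (genWeight n) (d₁ + d₂) = 2 * m) :
    MvPolynomial.monomial (d₁ + d₂) 1 ∈ S := by
  have h1 := weight_genWeight_pos h₁
  have h2 := weight_genWeight_pos h₂
  rw [map_add] at h
  have := S.mul_mem (hS d₁ e₁ (by omega)) (hS d₂ e₂ (by omega))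
  rwa [MvPolynomial.monomial_mul, one_mul] at this

/-- A decomposable element of weight `2 * m` lies in `S`. -/
theorem mem_of_mem_orderIdeal (hS : ContainsEvenBelow n m S) {p : ARing n}
    (hp : MvPolynomial.IsWeightedHomogeneous (genWeight n) p (2 * m))
    (h3 : p ∈ orderIdeal n 3) : p ∈ S := by
  rw [p.as_sum]
  refine sum_mem fun d hd => ?_
  rw [MvPolynomial.mem_support_iff] at hd
  have hw := hp hd
  have ho := h3 d hd
  rw [← mul_one (p.coeff d), ← smul_eq_mul (p.coeff d), ← MvPolynomial.smul_monomial]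
  refine S.smul_mem ?_ _
  have order_le (i : {j : ℕ // 2 ≤ j ∧ j ≤ n + 1}) : genOrder n i ≤ 2 := by
    rw [genOrder]
    split_ifs <;> omega
  have order_odd {i : {j : ℕ // 2 ≤ j ∧ j ≤ n + 1}} (hi : Odd (i : ℕ)) : genOrder n i = 1 :=
    if_neg (Nat.not_even_iff_odd.2 hi)
  rcases even_weight_cases (hw ▸ even_two_mul m) with
    rfl | ⟨i, -, rfl⟩ | ⟨i, j, hi, hj, rfl⟩ | ⟨d₁, d₂, rfl, h₁, h₂, e₁, e₂⟩
  · simp at ho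
  · rw [weight_single_one] at ho
    have := order_le i
    omega
  · rw [map_add, weight_single_one, weight_single_one, order_odd hi, order_odd hj] at ho
    omega
  · exact hS.monomial_add_mem h₁ h₂ e₁ e₂ hw

theorem aGen_mem (hS : ContainsEvenBelow n m S) {j : ℕ} (hj : Even j) (h : j < 2 * m) :
    aGen n j ∈ S := by
  rcases eq_or_ne j 0 with rfl | h0
  · rw [aGen_zero]
    exact S.one_mem
  by_cases h1 : 2 ≤ j ∧ j ≤ n + 1
  · rw [aGen_of_mem h1]
    refine hS (Finsupp.single ⟨j, h1⟩ 1) ?_ ?_ <;> rwa [weight_single_one]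
  · rw [aGen_eq_zero_s9 h0 h1]
    exact S.zero_mem

theorem aGen_mul_aGen_mem (hS : ContainsEvenBelow n m S) {j : ℕ} (hj : Even j) (h0 : 0 < j)
    (h : j < 2 * m) : aGen n j * aGen n (2 * m - j) ∈ S :=
  S.mul_mem (hS.aGen_mem hj h) (hS.aGen_mem ((Nat.even_sub h.le).2 (by simp [hj])) (by omega))

/-- The relation expressing `a_{2m}` through pairs of odd generators. -/
theorem aGen_sub_sum_mem (hS : ContainsEvenBelow n m S) {l : ℕ} (hm : 2 ≤ m)
    (hl : 2 * l = n + 2 * m) (h : piShriekLin n (psfw n 1 ^ l) ∈ S) :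
    aGen n (2 * m) - ∑ j ∈ Finset.Icc 2 (2 * m - 1), aGen n j * aGen n (2 * m - j) ∈ S := by
  have h1 := piShriekLin_psfw_one_pow_sub_mem hl (by omega)
  have h2 : aGen n 2 * piShriekLin n (X ^ (n + 2 * (m - 1))) ∈ orderIdeal n 3 :=
    mul_mem_orderIdeal (aGen_mem_orderIdeal_two (by norm_num) even_two)
      (piShriekLin_X_pow_mem_orderIdeal (by omega))
  have h3 := piShriekLin_X_pow_add_aGen_sub_sum_mem n (2 * m - 1)
  rw [show 2 * m - 1 + 1 = 2 * m by omega] at h3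
  have h4 : piShriekLin n (psfw n 1 ^ l) + (((n + 1) ^ l : ℕ) : ARing n) *
      (aGen n (2 * m) - ∑ j ∈ Finset.Icc 2 (2 * m - 1), aGen n j * aGen n (2 * m - j)) ∈
      orderIdeal n 3 := by
    have := sub_mem (add_mem h1 (Ideal.mul_mem_left _ (((n + 1 : ℕ) : ARing n) ^ l) h3))
      (Ideal.mul_mem_left _ ((2 * l * (n + 1) ^ (l - 1) : ℕ) : ARing n) h2)
    convert this using 1
    rw [Nat.cast_pow]
    ring
  have hp : IsTotalHomogeneous n (psfw n 1 ^ l) (n + 2 * m) := by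
    have := (isTotalHomogeneous_psfw n 1).pow l
    rwa [mul_one, mul_comm, hl] at this
  have h5 := hS.mem_of_mem_orderIdeal (hp.piShriekLin.add (isWeightedHomogeneous_natCast_mul _
    ((isWeightedHomogeneous_aGen n (2 * m)).sub
      (MvPolynomial.IsWeightedHomogeneous.sum _ _ _ fun j hj =>
        isWeightedHomogeneous_aGen_mul_aGen (by have := Finset.mem_Icc.1 hj; omega))))) h4
  exact mem_of_natCast_mul_mem (by positivity) ((add_mem_cancel_left h).1 h5)

theorem aGen_two_mem {l : ℕ} {S : Subalgebra ℚ (ARing n)} (hS : ContainsEvenBelow n 1 S)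
    (hl : 2 * l = n + 2 * 1) (h : piShriekLin n (psfw n 1 ^ l) ∈ S) : aGen n 2 ∈ S := by
  have h1 := piShriekLin_psfw_one_pow_sub_mem hl le_rfl
  have h2 : piShriekLin n (X ^ (n + 2 * 1)) = -aGen n 2 := by
    simpa using piShriekLin_X_pow_succ n 1
  have h3 : piShriekLin n (X ^ (n + 2 * (1 - 1))) = 1 := by
    simpa using piShriekLin_X_pow_of_le (le_refl n)
  have h4 : piShriekLin n (psfw n 1 ^ l) +
      (((n + 1) ^ l + 2 * l * (n + 1) ^ (l - 1) : ℕ) : ARing n) * aGen n 2 ∈ orderIdeal n 3 := by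
    convert h1 using 1
    rw [h2, h3]
    push_cast
    ring
  have hp : IsTotalHomogeneous n (psfw n 1 ^ l) (n + 2 * 1) := by
    have := (isTotalHomogeneous_psfw n 1).pow l
    rwa [mul_one, mul_comm, hl] at this
  have h5 := hS.mem_of_mem_orderIdeal (hp.piShriekLin.add
    (isWeightedHomogeneous_natCast_mul _ (isWeightedHomogeneous_aGen n 2))) h4
  exact mem_of_natCast_mul_mem (by positivity) ((add_mem_cancel_left h).1 h5)

/-- The relation expressing `a_{2s-1} a_{2m-2s+1}` through pairs with a smaller first index. -/
theorem sum_psfwCoeff_mem (hS : ContainsEvenBelow n m S) {l s : ℕ} (hn : n < 2 * l) (hs : s < m)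
    (hl : 2 * l + 2 * s = n + 2 * m) (h : piShriekLin n (psfw n 1 ^ l * betaCl n s) ∈ S) :
    ∑ j ∈ Finset.Icc 1 (2 * s),
      (psfwCoeff n s j : ARing n) * (aGen n j * aGen n (2 * m - j)) ∈ S := by
  have h1 := piShriekLin_psfw_one_pow_mul_betaCl_add_mem hn hs hl
  rw [← Nat.cast_pow] at h1
  have hp : IsTotalHomogeneous n (psfw n 1 ^ l * betaCl n s) (n + 2 * m) := by
    have := ((isTotalHomogeneous_psfw n 1).pow l).mul (isTotalHomogeneous_betaCl n s)
    rwa [mul_one, mul_comm l, hl] at this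
  have h2 := hS.mem_of_mem_orderIdeal (hp.piShriekLin.add (isWeightedHomogeneous_natCast_mul _
    (MvPolynomial.IsWeightedHomogeneous.sum _ _ _ fun j hj =>
      isWeightedHomogeneous_intCast_mul _ (isWeightedHomogeneous_aGen_mul_aGen
        (by have := Finset.mem_Icc.1 hj; omega))))) h1
  exact mem_of_natCast_mul_mem (by positivity) ((add_mem_cancel_left h).1 h2)

end ContainsEvenBelow

theorem piShriekLin_psfw_one_pow_mem {k l : ℕ} (h : (k + 1 ≤ l ∧ l ≤ 2 * k) ∨ l = 3 * k + 1) :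
    piShriekLin (2 * k) (psfw (2 * k) 1 ^ l) ∈ Algebra.adjoin ℚ (Set.range (evenFam k)) := by
  refine Algebra.subset_adjoin ?_
  rcases h with ⟨h1, h2⟩ | rfl
  · refine ⟨Sum.inl ⟨l - (k + 1), by omega⟩, ?_⟩
    simp only [evenFam]
    rw [Nat.add_sub_cancel' h1, piShriekLin_apply]
  · exact ⟨Sum.inr (Sum.inl ()), rfl⟩

theorem piShriekLin_psfw_one_pow_mul_betaCl_mem {k l s : ℕ} (h1 : 2 ≤ s) (h2 : s ≤ k)
    (h3 : k + s - 1 ≤ l) (h4 : l ≤ 2 * k) :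
    piShriekLin (2 * k) (psfw (2 * k) 1 ^ l * betaCl (2 * k) s) ∈
      Algebra.adjoin ℚ (Set.range (evenFam k)) :=
  Algebra.subset_adjoin ⟨Sum.inr (Sum.inr ⟨(s, l), h1, h2, h3, h4⟩), rfl⟩

theorem aGen_odd_mul_mem {k m : ℕ} (hm : 1 ≤ m)
    (hS : ContainsEvenBelow (2 * k) m (Algebra.adjoin ℚ (Set.range (evenFam k)))) (s : ℕ)
    (hs : 2 ≤ s) (hsm : 2 * s - 1 ≤ m) :
    aGen (2 * k) (2 * s - 1) * aGen (2 * k) (2 * m - (2 * s - 1)) ∈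
      Algebra.adjoin ℚ (Set.range (evenFam k)) := by
  induction s using Nat.strong_induction_on with
  | _ s ih =>
    rcases lt_or_ge (k + s) m with h | h
    · rw [aGen_eq_zero_s9 (j := 2 * m - (2 * s - 1)) (by omega) (by omega), mul_zero]
      exact zero_mem _
    rcases le_or_gt s k with hsk | hsk
    · have h1 := hS.sum_psfwCoeff_mem (l := m + k - s) (s := s) (by omega) (by omega) (by omega)
        (piShriekLin_psfw_one_pow_mul_betaCl_mem hs hsk (by omega) (by omega))
      rw [← Finset.add_sum_erase _ _ (Finset.mem_Icc.2 ⟨by omega, by omega⟩ :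
        2 * s - 1 ∈ Finset.Icc 1 (2 * s))] at h1
      refine mem_of_intCast_mul_mem (psfwCoeff_ne_zero (n := 2 * k) (s := s) (by omega) (by omega))
        ((add_mem_cancel_right (sum_mem fun j hj => ?_)).1 h1)
      rw [Finset.mem_erase, Finset.mem_Icc] at hj
      refine mul_mem (intCast_mem _ _) ?_
      rcases Nat.even_or_odd' j with ⟨c, rfl | rfl⟩
      · exact hS.aGen_mul_aGen_mem (even_two_mul c) (by omega) (by omega)
      · rcases Nat.eq_zero_or_pos c with rfl | hc
        · rw [aGen_eq_zero_s9 (j := 2 * 0 + 1) (by omega) (by omega), zero_mul]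
          exact zero_mem _
        · exact ih (c + 1) (by omega) (by omega) (by omega)
    · obtain ⟨rfl, rfl⟩ : s = k + 1 ∧ m = 2 * k + 1 := by omega
      have h1 := hS.aGen_sub_sum_mem (l := 3 * k + 1) (by omega) (by omega)
        (piShriekLin_psfw_one_pow_mem (Or.inr rfl))
      rw [aGen_eq_zero_s9 (j := 2 * (2 * k + 1)) (by omega) (by omega), zero_sub, neg_mem_iff,
        ← Finset.add_sum_erase _ _ (Finset.mem_Icc.2 ⟨by omega, by omega⟩ :
          2 * (k + 1) - 1 ∈ Finset.Icc 2 (2 * (2 * k + 1) - 1))] at h1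
      refine (add_mem_cancel_right (sum_mem fun j hj => ?_)).1 h1
      rw [Finset.mem_erase, Finset.mem_Icc] at hj
      rcases lt_or_ge (2 * k + 1) j with hj' | hj'
      · rw [aGen_eq_zero_s9 (by omega) (by omega), zero_mul]
        exact zero_mem _
      · rw [aGen_eq_zero_s9 (j := 2 * (2 * k + 1) - j) (by omega) (by omega), mul_zero]
        exact zero_mem _

theorem aGen_mul_aGen_mem_of_odd {k m j : ℕ} (hm : 1 ≤ m)
    (hS : ContainsEvenBelow (2 * k) m (Algebra.adjoin ℚ (Set.range (evenFam k))))
    (hj : Odd j) (hjm : j ≤ 2 * m) :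
    aGen (2 * k) j * aGen (2 * k) (2 * m - j) ∈ Algebra.adjoin ℚ (Set.range (evenFam k)) := by
  obtain ⟨c, rfl⟩ := hj
  rcases Nat.eq_zero_or_pos c with rfl | hc
  · rw [aGen_eq_zero_s9 (j := 2 * 0 + 1) (by omega) (by omega), zero_mul]
    exact zero_mem _
  rcases le_or_gt (2 * c + 1) m with h | h
  · exact aGen_odd_mul_mem hm hS (c + 1) (by omega) (by omega)
  rcases eq_or_ne (m - c) 1 with h1 | h1
  · rw [aGen_eq_zero_s9 (j := 2 * m - (2 * c + 1)) (by omega) (by omega), mul_zero]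
    exact zero_mem _
  · have := aGen_odd_mul_mem hm hS (m - c) (by omega) (by omega)
    rwa [mul_comm (aGen (2 * k) _), show 2 * m - (2 * (m - c) - 1) = 2 * c + 1 by omega,
      show 2 * (m - c) - 1 = 2 * m - (2 * c + 1) by omega] at this

theorem aGen_even_mem {k m : ℕ} (hm : 1 ≤ m)
    (hS : ContainsEvenBelow (2 * k) m (Algebra.adjoin ℚ (Set.range (evenFam k)))) :
    aGen (2 * k) (2 * m) ∈ Algebra.adjoin ℚ (Set.range (evenFam k)) := by
  rcases lt_or_ge k m with hkm | hkm
  · rw [aGen_eq_zero_s9 (by omega) (by omega)]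
    exact zero_mem _
  have hπ : piShriekLin (2 * k) (psfw (2 * k) 1 ^ (k + m)) ∈
      Algebra.adjoin ℚ (Set.range (evenFam k)) :=
    piShriekLin_psfw_one_pow_mem (Or.inl ⟨by omega, by omega⟩)
  rcases hm.eq_or_lt with rfl | hm2
  · exact hS.aGen_two_mem (by omega) hπ
  · rw [← sub_add_cancel (aGen (2 * k) (2 * m))
      (∑ j ∈ Finset.Icc 2 (2 * m - 1), aGen (2 * k) j * aGen (2 * k) (2 * m - j))]
    refine add_mem (hS.aGen_sub_sum_mem hm2 (by omega) hπ) (sum_mem fun j hj => ?_)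
    have hj := Finset.mem_Icc.1 hj
    rcases Nat.even_or_odd j with he | ho
    · exact hS.aGen_mul_aGen_mem he (by omega) (by omega)
    · exact aGen_mul_aGen_mem_of_odd hm hS ho (by omega)

theorem monomial_mem_adjoin_evenFam {k : ℕ} (m : ℕ)
    (d : {j : ℕ // 2 ≤ j ∧ j ≤ 2 * k + 1} →₀ ℕ)
    (hd : Finsupp.weight (genWeight (2 * k)) d = 2 * m) :
    MvPolynomial.monomial d 1 ∈ Algebra.adjoin ℚ (Set.range (evenFam k)) := by
  induction m using Nat.strong_induction_on generalizing d with
  | _ m ih =>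
    have hS : ContainsEvenBelow (2 * k) m (Algebra.adjoin ℚ (Set.range (evenFam k))) := by
      rintro d ⟨c, hc⟩ hlt
      exact ih c (by omega) d (by omega)
    rcases Nat.eq_zero_or_pos m with rfl | hm
    · have : d = 0 := by
        by_contra h
        have := weight_genWeight_pos h
        omega
      rw [this]
      exact one_mem _
    rcases even_weight_cases (hd ▸ even_two_mul m) with
      rfl | ⟨i, -, rfl⟩ | ⟨i, j, hi, -, rfl⟩ | ⟨d₁, d₂, rfl, h₁, h₂, e₁, e₂⟩
    · exact one_mem _
    · rw [weight_single_one, genWeight] at hd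
      have := aGen_even_mem hm hS
      rwa [← hd, aGen_of_mem i.2] at this
    · rw [map_add, weight_single_one, weight_single_one, genWeight, genWeight] at hd
      have := aGen_mul_aGen_mem_of_odd hm hS hi (by omega)
      rw [show 2 * m - i = j by omega, aGen_of_mem i.2, aGen_of_mem j.2] at this
      rw [← one_mul (1 : ℚ), ← MvPolynomial.monomial_mul]
      exact this
    · exact hS.monomial_add_mem h₁ h₂ e₁ e₂ hd

end Generation

section Fixed

theorem sigmaAut_monomial (n : ℕ) (d : {j : ℕ // 2 ≤ j ∧ j ≤ n + 1} →₀ ℕ) (c : ℚ) :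
    sigmaAut n (MvPolynomial.monomial d c) =
      MvPolynomial.monomial d ((-1) ^ Finsupp.weight (genWeight n) d * c) := by
  have h : (d.prod fun v e => ((-1 : ARing n) ^ (v : ℕ)) ^ e) =
      (-1) ^ Finsupp.weight (genWeight n) d := by
    rw [Finsupp.weight_apply, Finsupp.sum, ← Finset.prod_pow_eq_pow_sum, Finsupp.prod]
    refine Finset.prod_congr rfl fun v _ => ?_
    rw [← pow_mul, mul_comm, smul_eq_mul, genWeight]
  rw [sigmaAut, MvPolynomial.aeval_monomial]
  simp only [mul_pow]
  rw [Finsupp.prod_mul, h, MvPolynomial.monomial_eq, MvPolynomial.algebraMap_eq, map_mul, map_pow,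
    map_neg, map_one]
  ring

theorem coeff_sigmaAut (n : ℕ) (p : ARing n) (d : {j : ℕ // 2 ≤ j ∧ j ≤ n + 1} →₀ ℕ) :
    (sigmaAut n p).coeff d = (-1) ^ Finsupp.weight (genWeight n) d * p.coeff d := by
  classical
  induction p using MvPolynomial.induction_on' with
  | monomial u a =>
    rw [sigmaAut_monomial, MvPolynomial.coeff_monomial, MvPolynomial.coeff_monomial]
    split_ifs with h
    · rw [h]
    · rw [mul_zero]
  | add p q hp hq => rw [map_add, MvPolynomial.coeff_add, MvPolynomial.coeff_add, hp, hq, mul_add]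

theorem sigmaAut_eq_self {n m : ℕ} {p : ARing n}
    (hp : MvPolynomial.IsWeightedHomogeneous (genWeight n) p (2 * m)) : sigmaAut n p = p := by
  ext d
  rw [coeff_sigmaAut]
  by_cases h : p.coeff d = 0
  · rw [h, mul_zero]
  · rw [hp h, (even_two_mul m).neg_one_pow, one_mul]

theorem even_weight_of_sigmaAut_eq_self {n : ℕ} {p : ARing n} (hp : sigmaAut n p = p)
    {d : {j : ℕ // 2 ≤ j ∧ j ≤ n + 1} →₀ ℕ} (hd : p.coeff d ≠ 0) :
    Even (Finsupp.weight (genWeight n) d) := by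
  by_contra h
  have h1 := coeff_sigmaAut n p d
  rw [hp, (Nat.not_even_iff_odd.1 h).neg_one_pow] at h1
  exact hd (by linarith)

theorem sigmaAut_piShriek_eq_self {n l : ℕ} {g : Polynomial (ARing n)}
    (hg : IsTotalHomogeneous n g (2 * l)) (hn : Even n) (hl : n ≤ 2 * l) :
    sigmaAut n (piShriek n g) = piShriek n g := by
  obtain ⟨k, rfl⟩ := hn
  rw [show 2 * l = k + k + 2 * (l - k) by omega] at hg
  exact sigmaAut_eq_self hg.piShriekLin

theorem sigmaAut_evenFam (k : ℕ) : ∀ v, sigmaAut (2 * k) (evenFam k v) = evenFam k v := by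
  have hpow (l : ℕ) : IsTotalHomogeneous (2 * k) (psfw (2 * k) 1 ^ l) (2 * l) := by
    simpa [mul_comm] using (isTotalHomogeneous_psfw (2 * k) 1).pow l
  rintro (l | _ | ⟨⟨s, l⟩, h⟩)
  · exact sigmaAut_piShriek_eq_self (hpow _) (even_two_mul k) (by omega)
  · exact sigmaAut_piShriek_eq_self (hpow _) (even_two_mul k) (by omega)
  · have := (hpow l).mul (isTotalHomogeneous_betaCl (2 * k) s)
    rw [← mul_add] at this
    exact sigmaAut_piShriek_eq_self this (even_two_mul k) (by simp only at h; omega)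

end Fixed

theorem stmt9 (k : ℕ) (hk : 1 ≤ k) :
    (∀ v, sigmaAut (2 * k) (evenFam k v) = evenFam k v) ∧
    Algebra.adjoin ℚ (Set.range (evenFam k)) =
      AlgHom.equalizer (sigmaAut (2 * k)) (AlgHom.id ℚ (ARing (2 * k))) := by
  refine ⟨sigmaAut_evenFam k, le_antisymm (Algebra.adjoin_le ?_) fun p hp => ?_⟩
  · rintro _ ⟨v, rfl⟩
    exact sigmaAut_evenFam k v
  · rw [p.as_sum]
    refine sum_mem fun d hd => ?_
    obtain ⟨m, hm⟩ := even_weight_of_sigmaAut_eq_self (p := p) hp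
      (MvPolynomial.mem_support_iff.1 hd)
    rw [← mul_one (p.coeff d), ← smul_eq_mul (p.coeff d), ← MvPolynomial.smul_monomial]
    exact Subalgebra.smul_mem _ (monomial_mem_adjoin_evenFam m d (by omega)) _

end
end

section
/- Let n ≥ 1. Let S be the polynomial ring over ℚ in the indeterminates a₂, …, a_{n+1} together with c_{i|j} for 1 ≤ i ≤ n and 0 ≤ j < i, and let T = ℚ[c₁, …, c_{n+1}] be the polynomial ring over ℚ. Let q : S → T be the ℚ-algebra homomorphism defined by q(a_i) = Σ_{j=0}^{i} (−1)^j·C(n+1−i+j, j)·c_{i−j}·(c₁/(n+1))^j for 2 ≤ i ≤ n+1 (with the conventions c₀ = 1), and q(c_{i|j}) = C(n+1−i+j, j)·q(a_{i−j}) for 1 ≤ i ≤ n, 0 ≤ j < i (with the conventions q(a₀) = 1 and q(a₁) = 0). Then the kernel of q is the ideal of S generated by the elements c_{i|j} − C(n+1−i+j, j)·a_{i−j} for 1 ≤ i ≤ n and 0 ≤ j < i (with a₀ = 1 and a₁ = 0 in these expressions). -/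
/-!
Statement 12: the kernel of the map q modelling
H^*(B aut(τ_{ℂPⁿ});ℚ) → H^*(BU(n+1);ℚ).
S = ℚ[a₂,…,a_{n+1}, c_{i|j} (1 ≤ i ≤ n, 0 ≤ j < i)], T = ℚ[c₁,…,c_{n+1}],
q(a_i) = Σ_{j=0}^{i} (−1)^j C(n+1−i+j, j) c_{i−j} (c₁/(n+1))^j,
q(c_{i|j}) = C(n+1−i+j, j)·q(a_{i−j}), with q(a₀) = 1, q(a₁) = 0, c₀ = 1.
Then ker q is generated by the elements c_{i|j} − C(n+1−i+j, j)·a_{i−j}.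
-/

noncomputable section

/-- Index type for the variables a₂,…,a_{n+1} and c_{i|j} (1 ≤ i ≤ n, 0 ≤ j < i). -/
abbrev SVarIdx (n : ℕ) : Type :=
  {j : ℕ // 2 ≤ j ∧ j ≤ n + 1} ⊕ {ij : ℕ × ℕ // 1 ≤ ij.1 ∧ ij.1 ≤ n ∧ ij.2 < ij.1}

/-- The polynomial ring S = ℚ[a₂,…,a_{n+1}, c_{i|j}]. -/
abbrev SRing (n : ℕ) : Type := MvPolynomial (SVarIdx n) ℚ

/-- The polynomial ring T = ℚ[c₁,…,c_{n+1}]. -/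
abbrev TRing (n : ℕ) : Type := MvPolynomial {i : ℕ // 1 ≤ i ∧ i ≤ n + 1} ℚ

/-- The element a_i of S, with conventions a₀ = 1, a₁ = 0. -/
def aS (n : ℕ) (i : ℕ) : SRing n :=
  if i = 0 then 1 else
  if h : 2 ≤ i ∧ i ≤ n + 1 then MvPolynomial.X (Sum.inl ⟨i, h⟩) else 0

/-- The variable c_{i|j} of S. -/
def cS (n : ℕ) (i j : ℕ) : SRing n :=
  if h : 1 ≤ i ∧ i ≤ n ∧ j < i then MvPolynomial.X (Sum.inr ⟨(i, j), h⟩) else 0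

/-- The element c_i of T, with the convention c₀ = 1. -/
def cT (n : ℕ) (i : ℕ) : TRing n :=
  if i = 0 then 1 else
  if h : 1 ≤ i ∧ i ≤ n + 1 then MvPolynomial.X ⟨i, h⟩ else 0

/-- q(a_i) = Σ_{j=0}^{i} (−1)^j·C(n+1−i+j, j)·c_{i−j}·(c₁/(n+1))^j for i ≥ 2,
with q(a₀) = 1 and q(a₁) = 0. -/
def qa (n : ℕ) (i : ℕ) : TRing n :=
  if i = 0 then 1 else if i = 1 then 0 else
  ∑ j ∈ Finset.range (i + 1),
    (-1 : TRing n) ^ j * ((n + 1 - i + j).choose j : TRing n) * cT n (i - j) *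
      (MvPolynomial.C ((n + 1 : ℚ)⁻¹) * cT n 1) ^ j

/-- The ℚ-algebra homomorphism q : S → T. -/
def qHom (n : ℕ) : SRing n →ₐ[ℚ] TRing n :=
  MvPolynomial.aeval fun v : SVarIdx n =>
    match v with
    | Sum.inl ⟨i, _⟩ => qa n i
    | Sum.inr ⟨(i, j), _⟩ => ((n + 1 - i + j).choose j : TRing n) * qa n (i - j)

/-- The elements c_{i|j} − C(n+1−i+j, j)·a_{i−j} for 1 ≤ i ≤ n and 0 ≤ j < i. -/
def kerGens (n : ℕ) : Set (SRing n) :=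
  {x | ∃ i j : ℕ, 1 ≤ i ∧ i ≤ n ∧ j < i ∧
    x = cS n i j - ((n + 1 - i + j).choose j : SRing n) * aS n (i - j)}

theorem qHom_aS (n k : ℕ) (hk : k ≤ n + 1) : qHom n (aS n k) = qa n k := by
  unfold aS
  split_ifs with h0 h
  · simp [qa, h0]
  · simp [qHom]
  · have h1 : k = 1 := by omega
    simp [qa, h1]

theorem qHom_cS (n i j : ℕ) (h : 1 ≤ i ∧ i ≤ n ∧ j < i) :
    qHom n (cS n i j) = ((n + 1 - i + j).choose j : TRing n) * qa n (i - j) := by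
  simp [cS, h, qHom]

/-- The `ℚ`-algebra homomorphism `T → S` with `c₁ ↦ 0` and `c_i ↦ a_i` for `i ≥ 2`. -/
def chernSection (n : ℕ) : TRing n →ₐ[ℚ] SRing n :=
  MvPolynomial.aeval fun i => aS n i

theorem chernSection_cT (n i : ℕ) : chernSection n (cT n i) = aS n i := by
  unfold cT
  split_ifs with h0 h
  · simp [aS, h0]
  · simp [chernSection]
  · have h2 : ¬(2 ≤ i ∧ i ≤ n + 1) := by omega
    simp [aS, h0, h2]

theorem chernSection_qa (n i : ℕ) : chernSection n (qa n i) = aS n i := by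
  unfold qa
  split_ifs with h0 h1
  · simp [aS, h0]
  · simp [aS, h1]
  · have h : aS n 1 = 0 := by simp [aS]
    rw [map_sum, Finset.sum_eq_single 0]
    · simp [chernSection_cT]
    · intro j _ hj
      simp [chernSection_cT, h, hj]
    · simp

theorem mk_chernSection_qHom (n : ℕ) (x : SRing n) :
    Ideal.Quotient.mkₐ ℚ (Ideal.span (kerGens n)) (chernSection n (qHom n x)) =
      Ideal.Quotient.mkₐ ℚ (Ideal.span (kerGens n)) x := by
  suffices h : ((Ideal.Quotient.mkₐ ℚ (Ideal.span (kerGens n))).comp (chernSection n)).comp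
      (qHom n) = Ideal.Quotient.mkₐ ℚ (Ideal.span (kerGens n)) from DFunLike.congr_fun h x
  refine MvPolynomial.algHom_ext fun v => ?_
  rcases v with ⟨i, hi⟩ | ⟨⟨i, j⟩, hij⟩
  · have hX : (MvPolynomial.X (Sum.inl ⟨i, hi⟩) : SRing n) = aS n i := by
      have h0 : i ≠ 0 := by omega
      simp [aS, h0, hi]
    simp only [AlgHom.comp_apply]
    rw [hX, qHom_aS n i hi.2, chernSection_qa]
  · have hX : (MvPolynomial.X (Sum.inr ⟨(i, j), hij⟩) : SRing n) = cS n i j := by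
      rw [cS, dif_pos hij]
    simp only [AlgHom.comp_apply]
    rw [hX, qHom_cS n i j hij, map_mul, map_natCast, chernSection_qa]
    refine Eq.symm (Ideal.Quotient.eq.mpr (Ideal.subset_span ?_))
    exact ⟨i, j, hij.1, hij.2.1, hij.2.2, rfl⟩

theorem stmt12 (n : ℕ) (hn : 1 ≤ n) :
    RingHom.ker (qHom n).toRingHom = Ideal.span (kerGens n) := by
  refine le_antisymm (fun x hx => ?_) (Ideal.span_le.mpr ?_)
  · have hq : qHom n x = 0 := hx
    have h := mk_chernSection_qHom n x
    rw [hq, map_zero, map_zero] at h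
    exact Ideal.Quotient.eq_zero_iff_mem.mp h.symm
  · rintro x ⟨i, j, h1, h2, h3, rfl⟩
    change qHom n _ = 0
    rw [map_sub, map_mul, map_natCast, qHom_cS n i j ⟨h1, h2, h3⟩,
      qHom_aS n (i - j) (by omega), sub_self]

end
end

section
/- Let ℚ[u, v, w, s, t] be the polynomial ring over ℚ in five indeterminates and let ψ : ℚ[u, v, w, s, t] → ℚ[a₂, a₃, p₀, p₁] be the ℚ-algebra homomorphism with ψ(u) = a₂, ψ(v) = p₀, ψ(w) = p₁², ψ(s) = a₃·p₁, ψ(t) = a₃². Then the kernel of ψ is the principal ideal generated by s² − t·w. In particular, the image of ψ, namely the ℚ-subalgebra of ℚ[a₂, a₃, p₀, p₁] generated by a₂, p₀, p₁², a₃p₁ and a₃², is isomorphic to ℚ[u, v, w, s, t]/(s² − tw). -/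
/-!
Statement 13: the kernel of ψ : ℚ[u,v,w,s,t] → ℚ[a₂,a₃,p₀,p₁],
u ↦ a₂, v ↦ p₀, w ↦ p₁², s ↦ a₃p₁, t ↦ a₃², is the principal ideal (s² − tw);
in particular the subalgebra generated by a₂, p₀, p₁², a₃p₁, a₃² is isomorphic
to ℚ[u,v,w,s,t]/(s² − tw).

Variables: in `MvPolynomial (Fin 5) ℚ`: 0 = u, 1 = v, 2 = w, 3 = s, 4 = t;
in `MvPolynomial (Fin 4) ℚ`: 0 = a₂, 1 = a₃, 2 = p₀, 3 = p₁.
-/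

noncomputable section

open MvPolynomial

/-- ψ : ℚ[u,v,w,s,t] → ℚ[a₂,a₃,p₀,p₁], u ↦ a₂, v ↦ p₀, w ↦ p₁², s ↦ a₃·p₁, t ↦ a₃². -/
def psiHom : MvPolynomial (Fin 5) ℚ →ₐ[ℚ] MvPolynomial (Fin 4) ℚ :=
  aeval ![X 0, X 2, X 3 ^ 2, X 1 * X 3, X 1 ^ 2]

/-- The element s² − t·w of ℚ[u,v,w,s,t]. -/
def sstw : MvPolynomial (Fin 5) ℚ := X 3 ^ 2 - X 4 * X 2

/-- The exponent of the monomial to which `psiHom` sends the monomial with exponent `m`. -/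
def psiExponent (m : Fin 5 →₀ ℕ) : Fin 4 →₀ ℕ :=
  Finsupp.equivFunOnFinite.symm ![m 0, m 3 + 2 * m 4, m 1, 2 * m 2 + m 3]

/-- A `ℚ`-linear inverse of `psiHom` up to multiples of `sstw`: it lifts a monomial in the image
to the unique monomial over it whose degree in `s` is at most one. -/
def psiLift : MvPolynomial (Fin 4) ℚ →ₗ[ℚ] MvPolynomial (Fin 5) ℚ :=
  (basisMonomials (Fin 4) ℚ).constr ℚ fun n =>
    X 0 ^ n 0 * X 1 ^ n 2 * X 2 ^ (n 3 / 2) * X 3 ^ (n 3 % 2) * X 4 ^ (n 1 / 2)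

theorem psiLift_monomial_one (n : Fin 4 →₀ ℕ) :
    psiLift (monomial n 1) =
      X 0 ^ n 0 * X 1 ^ n 2 * X 2 ^ (n 3 / 2) * X 3 ^ (n 3 % 2) * X 4 ^ (n 1 / 2) :=
  (basisMonomials (Fin 4) ℚ).constr_basis ℚ _ n

theorem psiHom_monomial_one (m : Fin 5 →₀ ℕ) :
    psiHom (monomial m 1) = monomial (psiExponent m) 1 := by
  rw [psiHom, aeval_monomial, monomial_eq, Finsupp.prod_fintype _ _ (by simp),
    Finsupp.prod_fintype _ _ (by simp)]
  simp [Fin.prod_univ_succ, psiExponent]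
  ring

theorem mk_sq_eq :
    (Ideal.Quotient.mk (Ideal.span {sstw}) (X 3)) ^ 2 =
      Ideal.Quotient.mk (Ideal.span {sstw}) (X 4) * Ideal.Quotient.mk (Ideal.span {sstw}) (X 2) := by
  rw [← map_pow, ← map_mul, Ideal.Quotient.eq]
  exact Ideal.mem_span_singleton_self sstw

theorem mk_psiLift_psiHom (p : MvPolynomial (Fin 5) ℚ) :
    Ideal.Quotient.mkₐ ℚ (Ideal.span {sstw}) (psiLift (psiHom p)) =
      Ideal.Quotient.mkₐ ℚ (Ideal.span {sstw}) p := by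
  suffices h : (Ideal.Quotient.mkₐ ℚ (Ideal.span {sstw})).toLinearMap ∘ₗ psiLift ∘ₗ
      psiHom.toLinearMap = (Ideal.Quotient.mkₐ ℚ (Ideal.span {sstw})).toLinearMap from
    LinearMap.congr_fun h p
  refine (basisMonomials (Fin 5) ℚ).ext fun m => ?_
  simp only [coe_basisMonomials, LinearMap.comp_apply, AlgHom.toLinearMap_apply,
    psiHom_monomial_one, psiLift_monomial_one]
  rw [monomial_eq, Finsupp.prod_fintype _ _ (by simp)]
  have hw : (2 * m 2 + m 3) / 2 = m 2 + m 3 / 2 := by lia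
  have ht : (m 3 + 2 * m 4) / 2 = m 3 / 2 + m 4 := by lia
  have hs : (2 * m 2 + m 3) % 2 = m 3 % 2 := by lia
  simp only [psiExponent, Finsupp.equivFunOnFinite_symm_apply_apply, Matrix.cons_val, hw, ht, hs,
    Fin.prod_univ_five, Ideal.Quotient.mkₐ_eq_mk, map_mul, map_pow, map_one, one_mul]
  conv_rhs => rw [← Nat.div_add_mod (m 3) 2, pow_add, pow_mul, mk_sq_eq]
  ring

theorem ker_psiHom : RingHom.ker psiHom.toRingHom = Ideal.span {sstw} := by
  apply le_antisymm
  · intro p hp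
    have hp : psiHom p = 0 := hp
    have h := mk_psiLift_psiHom p
    rw [hp, map_zero, map_zero] at h
    exact Ideal.Quotient.eq_zero_iff_mem.mp h.symm
  · rw [Ideal.span_singleton_le_iff_mem]
    change psiHom sstw = 0
    simp [psiHom, sstw]
    ring

theorem stmt13 :
    RingHom.ker psiHom.toRingHom = Ideal.span {sstw} ∧
    Nonempty ((MvPolynomial (Fin 5) ℚ ⧸ Ideal.span {sstw}) ≃ₐ[ℚ] psiHom.range) := by
  have h : RingHom.ker psiHom.rangeRestrict = Ideal.span {sstw} :=
    psiHom.ker_rangeRestrict.trans ker_psiHom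
  exact ⟨ker_psiHom, ⟨(Ideal.quotientEquivAlgOfEq ℚ h.symm).trans
    (Ideal.quotientKerAlgEquivOfSurjective psiHom.rangeRestrict_surjective)⟩⟩

end
end
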